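/- Let M be a weight sequence satisfying (M.2) and (M.2)*, and let A be a weight sequence satisfying (M.2) and p! ⊂ A. Then 𝒦^{(M)}(ℝ^d) ∗ 𝒮^{(M)}_{(A)}(ℝ^d) = 𝒮^{(M)}_{(A)}(ℝ^d) ∗ 𝒮^{(M)}_{(A)}(ℝ^d) = 𝒮^{(M)}_{(A)}(ℝ^d); in particular, for every φ ∈ 𝒮^{(M)}_{(A)}(ℝ^d) there exist ψ ∈ 𝒦^{(M)}(ℝ^d) and χ ∈ 𝒮^{(M)}_{(A)}(ℝ^d) with φ = ψ ∗ χ, and conversely every such convolution lies in 𝒮^{(M)}_{(A)}(ℝ^d). Moreover, for every set B ⊆ 𝒮^{(M)}_{(A)}(ℝ^d) that is bounded in 𝒮^{(M)}_{(A)}(ℝ^d) (i.e., sup_{φ∈B} ‖φ‖_{𝒮^{M,h}_{A,h}} < ∞ for every h > 0) there exist ψ ∈ 𝒦^{(M)}(ℝ^d) and a bounded set A' ⊆ 𝒮^{(M)}_{(A)}(ℝ^d) with ψ ∗ A' = B. -/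

import Mathlib

open Filter MeasureTheory
open scoped BigOperators

noncomputable section

abbrev Rd (d : ℕ) := EuclideanSpace ℝ (Fin d)

/-- Partial derivative in the `j`-th coordinate direction. -/
def dop {d : ℕ} {E : Type*} [NormedAddCommGroup E] [NormedSpace ℝ E]
    (j : Fin d) (f : Rd d → E) : Rd d → E :=
  fun x => fderiv ℝ f x (EuclideanSpace.single j (1:ℝ))

/-- Iterated partial derivative `∂^α` for a multi-index `α : Fin d → ℕ`. -/
def pD {d : ℕ} {E : Type*} [NormedAddCommGroup E] [NormedSpace ℝ E]
    (α : Fin d → ℕ) (f : Rd d → E) : Rd d → E :=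
  (List.finRange d).foldr (fun j g => (dop j)^[α j] g) f

/-- Length `|α|` of a multi-index. -/
def msize {d : ℕ} (α : Fin d → ℕ) : ℕ := ∑ j, α j

/-- `M` is a weight sequence: positive, normalized, `M_p^{1/p} → ∞`, log-convex. -/
def IsWeightSeq (M : ℕ → ℝ) : Prop :=
  (∀ p, 0 < M p) ∧ M 0 = 1 ∧ M 1 = 1 ∧
  Tendsto (fun p : ℕ => (M p) ^ ((p : ℝ)⁻¹)) atTop atTop ∧
  ∀ p : ℕ, 1 ≤ p → (M p)^2 ≤ M (p-1) * M (p+1)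

/-- Condition (M.2) with explicit constants `C₀, H ≥ 1`. -/
def HasM2 (M : ℕ → ℝ) (C₀ H : ℝ) : Prop :=
  1 ≤ C₀ ∧ 1 ≤ H ∧ ∀ p q : ℕ, M (p+q) ≤ C₀ * H^(p+q) * M p * M q

/-- Condition (M.2). -/
def M2 (M : ℕ → ℝ) : Prop := ∃ C₀ H, HasM2 M C₀ H

/-- Condition (M.2)*: `2 m_p ≤ m_{Np}` for `p ≥ p₀`. -/
def M2star (M : ℕ → ℝ) : Prop :=
  ∃ p₀ N : ℕ, 0 < p₀ ∧ 0 < N ∧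
    ∀ p, p₀ ≤ p → 2 * (M p / M (p-1)) ≤ M (N*p) / M (N*p - 1)

/-- Associated function `ν_M(t) = sup_p log(t^p / M_p)`. -/
def nuA (M : ℕ → ℝ) (t : ℝ) : ℝ := ⨆ p : ℕ, Real.log (t ^ p / M p)

/-- `φ ∈ 𝒦^{(M)}(ℝ^d)` (Beurling type). -/
def KBeu (d : ℕ) (M : ℕ → ℝ) (φ : Rd d → ℂ) : Prop :=
  ContDiff ℝ (⊤ : ℕ∞) φ ∧ ∀ k : ℝ, 0 < k → ∀ n : ℕ, ∃ C : ℝ,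
    ∀ (α : Fin d → ℕ) (x : Rd d),
      k ^ msize α * ‖pD α φ x‖ * Real.exp ((n : ℝ) * ‖x‖) ≤ C * M (msize α)

/-- `φ ∈ 𝒦^{{M}}(ℝ^d)` (Roumieu type). -/
def KRou (d : ℕ) (M : ℕ → ℝ) (φ : Rd d → ℂ) : Prop :=
  ContDiff ℝ (⊤ : ℕ∞) φ ∧ ∃ k : ℝ, 0 < k ∧ ∀ n : ℕ, ∃ C : ℝ,
    ∀ (α : Fin d → ℕ) (x : Rd d),
      k ^ msize α * ‖pD α φ x‖ * Real.exp ((n : ℝ) * ‖x‖) ≤ C * M (msize α)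

/-- Convolution `(ψ ∗ χ)(x) = ∫ ψ(t) χ(x - t) dt`. -/
def convF {d : ℕ} (ψ χ : Rd d → ℂ) : Rd d → ℂ := fun x => ∫ t : Rd d, ψ t * χ (x - t)

/-- The set of all convolutions `ψ ∗ χ` with `ψ ∈ X`, `χ ∈ Y`. -/
def convSet {d : ℕ} (X Y : Set (Rd d → ℂ)) : Set (Rd d → ℂ) :=
  {f | ∃ ψ ∈ X, ∃ χ ∈ Y, f = convF ψ χ}

/-- The relation `p! ⊂ A`: `p! ≤ C L^p A_p`. -/
def factSubset (A : ℕ → ℝ) : Prop :=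
  ∃ C L : ℝ, 1 ≤ C ∧ 1 ≤ L ∧ ∀ p : ℕ, (p.factorial : ℝ) ≤ C * L ^ p * A p

/-- `φ ∈ 𝒮^{(M)}_{(A)}(ℝ^d)` (Gelfand–Shilov space of Beurling type). -/
def GSBeu (d : ℕ) (M A : ℕ → ℝ) (φ : Rd d → ℂ) : Prop :=
  ContDiff ℝ (⊤ : ℕ∞) φ ∧ ∀ h : ℝ, 0 < h → ∃ C : ℝ,
    ∀ (α : Fin d → ℕ) (x : Rd d),
      h ^ msize α * ‖pD α φ x‖ * Real.exp (nuA A (h * ‖x‖)) ≤ C * M (msize α)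

/-- Bounded subset of `𝒮^{(M)}_{(A)}(ℝ^d)`. -/
def GSBeuBdd (d : ℕ) (M A : ℕ → ℝ) (B : Set (Rd d → ℂ)) : Prop :=
  (∀ φ ∈ B, GSBeu d M A φ) ∧ ∀ h : ℝ, 0 < h → ∃ C : ℝ,
    ∀ φ ∈ B, ∀ (α : Fin d → ℕ) (x : Rd d),
      h ^ msize α * ‖pD α φ x‖ * Real.exp (nuA A (h * ‖x‖)) ≤ C * M (msize α)

open scoped FourierTransform ContDiff RealInnerProductSpace

/-- Continuous functions decaying faster than every power of `‖x‖`. -/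
def RapidDecay {d : ℕ} (f : Rd d → ℂ) : Prop :=
  Continuous f ∧ ∀ n : ℕ, ∃ C : ℝ, ∀ x, ‖x‖ ^ n * ‖f x‖ ≤ C

/-- Derivative in the direction `v`. -/
def dirD {d : ℕ} (v : Rd d) (f : Rd d → ℂ) : Rd d → ℂ := fun x => fderiv ℝ f x v

/-- The integrable weight `(1 + ‖x‖)^{-(d+1)}`. -/
def decayWeight (d : ℕ) (x : Rd d) : ℝ := ((1 + ‖x‖) ^ (d + 1))⁻¹

lemma decayWeight_pos {d : ℕ} (x : Rd d) : 0 < decayWeight d x := by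
  unfold decayWeight; positivity

lemma integrable_decayWeight (d : ℕ) : Integrable (decayWeight d) := by
  have h := integrable_one_add_norm (E := Rd d) (μ := volume) (r := (d : ℝ) + 1) (by simp)
  refine h.congr (Eventually.of_forall fun x => ?_)
  simp only [decayWeight]
  rw [Real.rpow_neg (by positivity)]
  congr 1
  exact_mod_cast Real.rpow_natCast (1 + ‖x‖) (d + 1)

lemma norm_le_decayWeight {d : ℕ} {y : ℝ} {x : Rd d} {C₀ C₁ : ℝ} (h0 : y ≤ C₀)
    (h1 : ‖x‖ ^ (d + 1) * y ≤ C₁) (hy : 0 ≤ y) :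
    y ≤ 2 ^ d * (C₀ + C₁) * decayWeight d x := by
  unfold decayWeight
  rw [← div_eq_mul_inv, le_div_iff₀ (by positivity)]
  have h2 : (1 + ‖x‖) ^ (d + 1) ≤ 2 ^ d * (1 ^ (d + 1) + ‖x‖ ^ (d + 1)) :=
    add_pow_le (by norm_num) (norm_nonneg _) (d + 1)
  calc y * (1 + ‖x‖) ^ (d + 1) ≤ y * (2 ^ d * (1 ^ (d + 1) + ‖x‖ ^ (d + 1))) := by gcongr
    _ = 2 ^ d * (y + ‖x‖ ^ (d + 1) * y) := by ring
    _ ≤ _ := by gcongr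

namespace RapidDecay

variable {d : ℕ} {f g : Rd d → ℂ}

lemma integrable (hf : RapidDecay f) : Integrable f := by
  obtain ⟨C₀, h0⟩ := hf.2 0
  obtain ⟨C₁, h1⟩ := hf.2 (d + 1)
  refine ((integrable_decayWeight d).const_mul (2 ^ d * (C₀ + C₁))).mono'
    hf.1.aestronglyMeasurable (Eventually.of_forall fun x => ?_)
  exact norm_le_decayWeight (by simpa using h0 x) (h1 x) (norm_nonneg _)

lemma mul_bounded (hf : RapidDecay f) (hg : Continuous g) {C : ℝ} (hC : ∀ x, ‖g x‖ ≤ C) :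
    RapidDecay (fun x => g x * f x) := by
  refine ⟨hg.mul hf.1, fun n => ?_⟩
  obtain ⟨D, hD⟩ := hf.2 n
  refine ⟨C * D, fun x => ?_⟩
  have hC0 : 0 ≤ C := (norm_nonneg _).trans (hC x)
  calc ‖x‖ ^ n * ‖g x * f x‖ = ‖g x‖ * (‖x‖ ^ n * ‖f x‖) := by rw [norm_mul]; ring
    _ ≤ C * D := mul_le_mul (hC x) (hD x) (by positivity) hC0

lemma mul_growth (hf : RapidDecay f) (hg : Continuous g) {C : ℝ} {m : ℕ}
    (hC : ∀ x, ‖g x‖ ≤ C * ‖x‖ ^ m) : RapidDecay (fun x => g x * f x) := by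
  refine ⟨hg.mul hf.1, fun n => ?_⟩
  obtain ⟨D, hD⟩ := hf.2 (n + m)
  refine ⟨|C| * D, fun x => ?_⟩
  calc ‖x‖ ^ n * ‖g x * f x‖ = ‖x‖ ^ n * (‖g x‖ * ‖f x‖) := by rw [norm_mul]
    _ ≤ ‖x‖ ^ n * ((|C| * ‖x‖ ^ m) * ‖f x‖) := by
        gcongr
        exact (hC x).trans (by gcongr; exact le_abs_self C)
    _ = |C| * (‖x‖ ^ (n + m) * ‖f x‖) := by ring
    _ ≤ _ := by gcongr; exact hD x

lemma inner_mul (hf : RapidDecay f) (c : ℂ) (v : Rd d) :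
    RapidDecay (fun x => c * (⟪x, v⟫ : ℝ) * f x) := by
  refine hf.mul_growth (by fun_prop) (C := ‖c‖ * ‖v‖) (m := 1) fun x => ?_
  rw [norm_mul, Complex.norm_real, pow_one, mul_assoc]
  gcongr
  rw [mul_comm]; exact norm_inner_le_norm x v

lemma integrable_pow_mul (hf : RapidDecay f) (n : ℕ) :
    Integrable (fun x => ‖x‖ ^ n * ‖f x‖) := by
  have : RapidDecay (fun x => ((‖x‖ ^ n : ℝ) : ℂ) * f x) :=
    hf.mul_growth (by fun_prop) (C := 1) (m := n) (fun x => by simp)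
  refine this.integrable.norm.congr (Eventually.of_forall fun x => ?_)
  simp

lemma contDiff_fourier (hf : RapidDecay f) : ContDiff ℝ ∞ (𝓕 f) :=
  Real.contDiff_fourier fun n _ => hf.integrable_pow_mul n

lemma contDiff_fourierInv (hf : RapidDecay f) : ContDiff ℝ ∞ (𝓕⁻ f) := by
  have : (𝓕⁻ f) = fun x => 𝓕 f (-x) := by ext x; exact Real.fourierInv_eq_fourier_neg f x
  rw [this]
  exact hf.contDiff_fourier.comp contDiff_neg

lemma dirD_fourier (hf : RapidDecay f) (v : Rd d) :
    dirD v (𝓕 f) = 𝓕 (fun x => (-(2 * Real.pi * Complex.I)) * (⟪x, v⟫ : ℝ) * f x) := by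
  ext x
  have h1 : Integrable (fun v ↦ ‖v‖ * ‖f v‖) := by simpa using hf.integrable_pow_mul 1
  have h2 : Integrable (VectorFourier.fourierSMulRight (innerSL ℝ) f) := by
    refine Integrable.mono' (h1.const_mul (2 * Real.pi * ‖innerSL ℝ (E := Rd d)‖))
      hf.integrable.1.fourierSMulRight
      (Eventually.of_forall fun x => ?_)
    refine (VectorFourier.norm_fourierSMulRight_le (innerSL ℝ) f x).trans (le_of_eq (by ring))
  rw [dirD, Real.fderiv_fourier hf.integrable h1, Real.fourier_continuousLinearMap_apply h2]
  refine congrFun (congrArg _ ?_) x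
  ext y
  have : innerSL ℝ y v = (⟪y, v⟫ : ℝ) := rfl
  simp [VectorFourier.fourierSMulRight_apply, this]
  ring

lemma dirD_fourierInv (hf : RapidDecay f) (v : Rd d) :
    dirD v (𝓕⁻ f) = 𝓕⁻ (fun x => (2 * Real.pi * Complex.I) * (⟪x, v⟫ : ℝ) * f x) := by
  ext x
  have e : (𝓕⁻ f) = fun x => 𝓕 f (-x) := by ext x; exact Real.fourierInv_eq_fourier_neg f x
  have h := congrFun (hf.dirD_fourier v) (-x)
  rw [Real.fourierInv_eq_fourier_neg]
  unfold dirD at h ⊢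
  rw [e]
  have hd : DifferentiableAt ℝ (𝓕 f) (-x) := (hf.contDiff_fourier.differentiable (by simp)) _
  have h3 : fderiv ℝ (fun x => 𝓕 f (-x)) x = (fderiv ℝ (𝓕 f) (-x)).comp (-ContinuousLinearMap.id ℝ (Rd d)) := by
    have := (hd.hasFDerivAt).comp x (hasFDerivAt_id x).neg
    exact this.fderiv
  rw [h3]
  simp only [ContinuousLinearMap.comp_apply, neg_apply, map_neg,
    ContinuousLinearMap.id_apply, h]
  rw [Real.fourier_eq, Real.fourier_eq, ← integral_neg]
  congr 1; ext y
  simp [Circle.smul_def]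

end RapidDecay

lemma hasFDerivAt_fourierKernel {d : ℕ} (ξ y : Rd d) :
    HasFDerivAt (fun y : Rd d => Complex.exp (((-2 * Real.pi * ⟪y, ξ⟫ : ℝ) : ℂ) * Complex.I))
      (Complex.exp (((-2 * Real.pi * ⟪y, ξ⟫ : ℝ) : ℂ) * Complex.I) •
        ((Complex.I * (-2 * Real.pi)) • (Complex.ofRealCLM.comp (innerSL ℝ ξ)))) y := by
  apply HasFDerivAt.cexp
  have h1 : HasFDerivAt
      (fun y : Rd d => ((Complex.I * (-2 * Real.pi)) • (Complex.ofRealCLM.comp (innerSL ℝ ξ))) y)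
      ((Complex.I * (-2 * Real.pi)) • (Complex.ofRealCLM.comp (innerSL ℝ ξ))) y :=
    ContinuousLinearMap.hasFDerivAt _
  refine h1.congr_of_eventuallyEq (Eventually.of_forall fun y => ?_)
  simp [real_inner_comm y ξ]
  ring

/-- Integration by parts on the Fourier side. -/
lemma fourier_dirD {d : ℕ} {f : Rd d → ℂ} (hf : Differentiable ℝ f) (hi : Integrable f)
    {v : Rd d} (hi' : Integrable (dirD v f)) (ξ : Rd d) :
    𝓕 (dirD v f) ξ = (2 * Real.pi * Complex.I) * (⟪ξ, v⟫ : ℝ) * 𝓕 f ξ := by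
  obtain ⟨e, he⟩ : ∃ e : Rd d → ℂ, e = fun y : Rd d =>
      Complex.exp (((-2 * Real.pi * ⟪y, ξ⟫ : ℝ) : ℂ) * Complex.I) := ⟨_, rfl⟩
  have hE : ∀ y : Rd d, HasFDerivAt e
      (e y • ((Complex.I * (-2 * Real.pi)) • (Complex.ofRealCLM.comp (innerSL ℝ ξ)))) y := by
    intro y; rw [he]; exact hasFDerivAt_fourierKernel ξ y
  have hcont : Continuous e := by
    rw [he]; fun_prop
  have hn : ∀ y : Rd d, ‖e y‖ ≤ 1 := fun y => by
    rw [he]; exact (Complex.norm_exp_ofReal_mul_I _).le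
  have hA : ∀ {h : Rd d → ℂ}, Integrable h → Integrable (fun y => e y * h y) := fun hh =>
    hh.bdd_mul hcont.aestronglyMeasurable (Eventually.of_forall hn)
  have hfd : ∀ y, fderiv ℝ e y v = (-(2 * Real.pi * Complex.I) * (⟪ξ, v⟫ : ℝ)) * e y := by
    intro y
    rw [(hE y).fderiv]
    simp
    ring
  have hfd' : (fun y => fderiv ℝ e y v * f y) =
      fun y => (-(2 * Real.pi * Complex.I) * (⟪ξ, v⟫ : ℝ)) * (e y * f y) := by
    ext y; rw [hfd, mul_assoc]
  have key := integral_mul_fderiv_eq_neg_fderiv_mul_of_integrable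
    (μ := (volume : Measure (Rd d))) (f := e) (g := f) (v := v)
    (by rw [hfd']; exact (hA hi).const_mul _)
    (hA hi') (hA hi) (fun y _ => (hE y).differentiableAt) (fun y _ => hf y)
  rw [hfd', integral_const_mul] at key
  have e1 : 𝓕 (dirD v f) ξ = ∫ y, e y * fderiv ℝ f y v := by
    rw [Real.fourier_eq', he]; rfl
  have e2 : 𝓕 f ξ = ∫ y, e y * f y := by
    rw [Real.fourier_eq', he]; rfl
  rw [e1, e2, key]
  ring

lemma contDiff_dirD {d : ℕ} {f : Rd d → ℂ} (hf : ContDiff ℝ ∞ f) (v : Rd d) :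
    ContDiff ℝ ∞ (dirD v f) :=
  (hf.fderiv_right (m := ∞) (by simp)).clm_apply contDiff_const

lemma contDiff_dirD_iterate {d : ℕ} {f : Rd d → ℂ} (hf : ContDiff ℝ ∞ f) (v : Rd d) (p : ℕ) :
    ContDiff ℝ ∞ ((dirD v)^[p] f) := by
  induction p with
  | zero => exact hf
  | succ p ih => rw [Function.iterate_succ_apply']; exact contDiff_dirD ih v

lemma fourier_dirD_iterate {d : ℕ} {f : Rd d → ℂ} (hf : ContDiff ℝ ∞ f) {v : Rd d}
    (hi : ∀ p, Integrable ((dirD v)^[p] f)) (p : ℕ) (ξ : Rd d) :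
    𝓕 ((dirD v)^[p] f) ξ = ((2 * Real.pi * Complex.I) * (⟪ξ, v⟫ : ℝ)) ^ p * 𝓕 f ξ := by
  induction p with
  | zero => simp
  | succ p ih =>
    have := hi (p + 1)
    rw [Function.iterate_succ_apply'] at this ⊢
    rw [fourier_dirD ((contDiff_dirD_iterate hf v p).differentiable (by simp)) (hi p) this, ih]
    ring

lemma fourierInv_dirD_iterate {d : ℕ} {f : Rd d → ℂ} (hf : ContDiff ℝ ∞ f) {v : Rd d}
    (hi : ∀ p, Integrable ((dirD v)^[p] f)) (p : ℕ) (ξ : Rd d) :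
    𝓕⁻ ((dirD v)^[p] f) ξ = (-(2 * Real.pi * Complex.I) * (⟪ξ, v⟫ : ℝ)) ^ p * 𝓕⁻ f ξ := by
  rw [Real.fourierInv_eq_fourier_neg, Real.fourierInv_eq_fourier_neg, fourier_dirD_iterate hf hi]
  simp

lemma RapidDecay.dirD_iterate_fourier {d : ℕ} {f : Rd d → ℂ} (hf : RapidDecay f) (v : Rd d)
    (p : ℕ) : RapidDecay (fun x => (-(2 * Real.pi * Complex.I) * (⟪x, v⟫ : ℝ)) ^ p * f x) ∧
    (dirD v)^[p] (𝓕 f) = 𝓕 (fun x => (-(2 * Real.pi * Complex.I) * (⟪x, v⟫ : ℝ)) ^ p * f x) := by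
  induction p with
  | zero => simpa using hf
  | succ p ih =>
    rw [Function.iterate_succ_apply', ih.2, ih.1.dirD_fourier]
    have : (fun x => (-(2 * Real.pi * Complex.I)) * (⟪x, v⟫ : ℝ) *
      ((-(2 * Real.pi * Complex.I) * (⟪x, v⟫ : ℝ)) ^ p * f x)) =
      (fun x => (-(2 * Real.pi * Complex.I) * (⟪x, v⟫ : ℝ)) ^ (p+1) * f x) := by
      ext x; ring
    exact ⟨this ▸ ih.1.inner_mul _ v, by rw [this]⟩

lemma norm_fourierInv_le_integral {d : ℕ} (f : Rd d → ℂ) (x : Rd d) :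
    ‖𝓕⁻ f x‖ ≤ ∫ y, ‖f y‖ := by
  rw [Real.fourierInv_eq]
  exact (norm_integral_le_integral_norm _).trans (le_of_eq (by simp))

lemma norm_fourier_le_integral {d : ℕ} (f : Rd d → ℂ) (x : Rd d) :
    ‖𝓕 f x‖ ≤ ∫ y, ‖f y‖ := by
  rw [Real.fourier_eq]
  exact (norm_integral_le_integral_norm _).trans (le_of_eq (by simp))

lemma convF_fourierInv {d : ℕ} {ψ Φ : Rd d → ℂ} (hψ : Integrable ψ) (hΦ : Integrable Φ) :
    convF ψ (𝓕⁻ Φ) = 𝓕⁻ (fun ξ => 𝓕 ψ ξ * Φ ξ) := by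
  ext x
  have hc : Integrable (fun ξ : Rd d => Complex.exp (((2 * Real.pi * ⟪ξ, x⟫ : ℝ) : ℂ) * Complex.I) * Φ ξ) :=
    hΦ.bdd_mul (c := 1) (by fun_prop) (Eventually.of_forall fun y => (Complex.norm_exp_ofReal_mul_I _).le)
  have h := VectorFourier.integral_fourierIntegral_smul_eq_flip (μ := (volume : Measure (Rd d)))
    (ν := (volume : Measure (Rd d))) (L := innerₗ (Rd d)) (e := Real.fourierChar) Real.continuous_fourierChar
    (by simpa using continuous_inner) hψ hc
  rw [Real.fourierInv_eq']
  simp only [smul_eq_mul, flip_innerₗ] at h ⊢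
  have e1 : ∀ t, (𝓕⁻ Φ) (x - t) = VectorFourier.fourierIntegral Real.fourierChar volume (innerₗ (Rd d))
     (fun ξ : Rd d => Complex.exp (((2 * Real.pi * ⟪ξ, x⟫ : ℝ) : ℂ) * Complex.I) * Φ ξ) t := by
    intro t
    refine Eq.trans ?_ (Real.fourier_eq' (fun ξ : Rd d =>
      Complex.exp (((2 * Real.pi * ⟪ξ, x⟫ : ℝ) : ℂ) * Complex.I) * Φ ξ) t).symm
    rw [Real.fourierInv_eq']
    congr 1; ext ξ
    simp only [smul_eq_mul]
    rw [← mul_assoc, ← Complex.exp_add]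
    congr 2
    rw [inner_sub_right]; push_cast; ring
  unfold convF
  simp_rw [e1]
  rw [← h]
  congr 1; ext ξ
  change 𝓕 ψ ξ * _ = _
  ring

/-- Multi-index power `∏ (c ξ_j)^{α_j}`. -/
def monom {d : ℕ} (c : ℂ) (α : Fin d → ℕ) (ξ : Rd d) : ℂ := ∏ j, (c * (ξ j : ℂ)) ^ α j

lemma RapidDecay.dop_iterate_fourierInv {d : ℕ} {f : Rd d → ℂ} (hf : RapidDecay f) (j : Fin d)
    (n : ℕ) : RapidDecay (fun ξ => (2 * Real.pi * Complex.I * (ξ j : ℂ)) ^ n * f ξ) ∧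
      (dop j)^[n] (𝓕⁻ f) = 𝓕⁻ (fun ξ => (2 * Real.pi * Complex.I * (ξ j : ℂ)) ^ n * f ξ) := by
  induction n with
  | zero => simpa using hf
  | succ p ih =>
    rw [Function.iterate_succ_apply', ih.2]
    have h1 := ih.1.dirD_fourierInv (EuclideanSpace.single j (1:ℝ))
    have h2 := ih.1.inner_mul (2 * Real.pi * Complex.I) (EuclideanSpace.single j (1:ℝ))
    have : (fun x : Rd d => (2 * Real.pi * Complex.I) * ((⟪x, EuclideanSpace.single j (1:ℝ)⟫ : ℝ) : ℂ) *
      ((2 * Real.pi * Complex.I * (x j : ℂ)) ^ p * f x)) =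
      (fun x => (2 * Real.pi * Complex.I * (x j : ℂ)) ^ (p+1) * f x) := by
      ext x;
      simp [EuclideanSpace.inner_single_right]; ring
    rw [this] at h1 h2
    exact ⟨h2, h1⟩

lemma RapidDecay.pD_fourierInv {d : ℕ} {f : Rd d → ℂ} (hf : RapidDecay f) (α : Fin d → ℕ) :
    RapidDecay (fun ξ => monom (2 * Real.pi * Complex.I) α ξ * f ξ) ∧
      pD α (𝓕⁻ f) = 𝓕⁻ (fun ξ => monom (2 * Real.pi * Complex.I) α ξ * f ξ) := by
  have key : ∀ l : List (Fin d),
      RapidDecay (fun ξ => (l.map fun j => (2 * Real.pi * Complex.I * (ξ j : ℂ)) ^ α j).prod * f ξ) ∧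
      l.foldr (fun j g => (dop j)^[α j] g) (𝓕⁻ f) =
       𝓕⁻ (fun ξ => (l.map fun j => (2 * Real.pi * Complex.I * (ξ j : ℂ)) ^ α j).prod * f ξ) := by
    intro l
    induction l with
    | nil => simpa using hf
    | cons j l ih =>
      have h := ih.1.dop_iterate_fourierInv j (α j)
      simp only [List.map_cons, List.prod_cons, List.foldr_cons, mul_assoc] at h ih ⊢
      rw [ih.2]
      exact h
  have := key (List.finRange d)
  simp only [← List.ofFn_eq_map, List.prod_ofFn] at this
  exact this

/-- The quotient sequence `m_p = M_p / M_{p-1}` (with `m_0 = 1`). -/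
def quot (M : ℕ → ℝ) (p : ℕ) : ℝ := M p / M (p - 1)

namespace IsWeightSeq

variable {M : ℕ → ℝ}

lemma pos (hM : IsWeightSeq M) (p : ℕ) : 0 < M p := hM.1 p

lemma quot_pos (hM : IsWeightSeq M) (p : ℕ) : 0 < quot M p := div_pos (hM.pos _) (hM.pos _)

lemma succ_eq (hM : IsWeightSeq M) (p : ℕ) : M (p + 1) = M p * quot M (p + 1) := by
  have := (hM.pos p).ne'
  simp only [quot, Nat.add_sub_cancel]; field_simp

lemma quot_zero (hM : IsWeightSeq M) : quot M 0 = 1 := by simp [quot, hM.2.1]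

lemma quot_mono (hM : IsWeightSeq M) : Monotone (quot M) := by
  refine monotone_nat_of_le_succ fun p => ?_
  rcases Nat.eq_zero_or_pos p with rfl | hp
  · simp [quot, hM.2.1, hM.2.2.1]
  · have := hM.2.2.2.2 p hp
    simp only [quot, Nat.add_sub_cancel]
    rw [div_le_div_iff₀ (hM.pos _) (hM.pos _)]
    nlinarith

lemma one_le_quot (hM : IsWeightSeq M) (p : ℕ) : 1 ≤ quot M p :=
  hM.quot_zero ▸ hM.quot_mono (Nat.zero_le p)

lemma mul_le_add (hM : IsWeightSeq M) (p q : ℕ) : M p * M q ≤ M (p + q) := by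
  induction q with
  | zero => simp [hM.2.1]
  | succ q ih =>
    rw [← add_assoc, hM.succ_eq q, hM.succ_eq (p + q), ← mul_assoc]
    exact mul_le_mul ih (hM.quot_mono (by omega)) (hM.quot_pos _).le (hM.pos _).le

end IsWeightSeq

lemma iteratedDeriv_line {d : ℕ} {f : Rd d → ℂ} (hf : ContDiff ℝ ∞ f) (ξ v : Rd d) (p : ℕ) (τ : ℝ) :
    iteratedDeriv p (fun t : ℝ => f (ξ + t • v)) τ = (dirD v)^[p] f (ξ + τ • v) := by
  induction p generalizing τ with
  | zero => simp
  | succ p ih =>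
    rw [iteratedDeriv_succ, Function.iterate_succ_apply']
    have : iteratedDeriv p (fun t : ℝ => f (ξ + t • v)) =
        fun t => (dirD v)^[p] f (ξ + t • v) := by ext t; exact ih t
    rw [this]
    have h1 : HasDerivAt (fun t : ℝ => ξ + t • v) v τ := by
      simpa using ((hasDerivAt_id τ).smul_const v).const_add ξ
    have h2 := ((contDiff_dirD_iterate hf v p).differentiable (by simp)) (ξ + τ • v)
    exact (h2.hasFDerivAt.comp_hasDerivAt τ h1).deriv

lemma iteratedDeriv_comp_ofReal {H : ℂ → ℂ} {r : ℝ}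
    (hH : DifferentiableOn ℂ H (Metric.ball 0 r)) (p : ℕ) :
    ∀ τ : ℝ, |τ| < r → iteratedDeriv p (fun t : ℝ => H t) τ = iteratedDeriv p H τ := by
  induction p with
  | zero => simp
  | succ p ih =>
    intro τ hτ
    rw [iteratedDeriv_succ, iteratedDeriv_succ]
    have hev : iteratedDeriv p (fun t : ℝ => H t) =ᶠ[nhds τ] fun t : ℝ => iteratedDeriv p H t := by
      have : ∀ᶠ t in nhds τ, |t| < r := (continuous_abs.isOpen_preimage _ isOpen_Iio).mem_nhds hτ
      filter_upwards [this] with t ht using ih t ht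
    rw [hev.deriv_eq]
    have hmem : (τ : ℂ) ∈ Metric.ball (0:ℂ) r := by simpa using hτ
    have hA : AnalyticAt ℂ H τ := hH.analyticAt (Metric.isOpen_ball.mem_nhds hmem)
    have hA' : AnalyticAt ℂ (iteratedDeriv p H) τ := by
      rw [iteratedDeriv_eq_iterate]; exact hA.iterated_deriv p
    exact hA'.differentiableAt.hasDerivAt.comp_ofReal.deriv

lemma contDiffAt_comp_ofReal {H : ℂ → ℂ} {r : ℝ} (hr : 0 < r)
    (hH : DifferentiableOn ℂ H (Metric.ball 0 r)) :
    ContDiffAt ℝ ∞ (fun t : ℝ => H t) 0 := by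
  have hA : AnalyticAt ℂ H ((0 : ℝ) : ℂ) :=
    hH.analyticAt (Metric.isOpen_ball.mem_nhds (by simpa using hr))
  have h1 : ContDiffAt ℝ ∞ H ((0 : ℝ) : ℂ) := (hA.contDiffAt (n := ∞)).restrict_scalars ℝ
  exact h1.comp (0 : ℝ) Complex.ofRealCLM.contDiff.contDiffAt

lemma norm_iteratedDeriv_mul_le {A : ℕ → ℝ} (hA : ∀ p, 0 < A p)
    (hAmul : ∀ p q, A p * A q ≤ A (p + q)) {C L : ℝ} (hC : 0 ≤ C) (hL : 1 ≤ L)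
    (hfact : ∀ p : ℕ, (p.factorial : ℝ) ≤ C * L ^ p * A p) {R B D : ℝ} (hR : 0 < R)
    (hB : 0 ≤ B) (hD : 0 ≤ D) {h g : ℝ → ℂ} (hh : ContDiffAt ℝ ∞ h 0) (hg : ContDiffAt ℝ ∞ g 0)
    (h1 : ∀ l, ‖iteratedDeriv l h 0‖ ≤ l.factorial * B / R ^ l)
    (h2 : ∀ q, ‖iteratedDeriv q g 0‖ ≤ D * A q / R ^ q) (p : ℕ) :
    ‖iteratedDeriv p (fun t => h t * g t) 0‖ ≤ C * B * D * (2 * L / R) ^ p * A p := by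
  rw [iteratedDeriv_fun_mul (hh.of_le (by exact_mod_cast le_top)) (hg.of_le (by exact_mod_cast le_top))]
  calc _ ≤ ∑ i ∈ Finset.range (p + 1), (p.choose i : ℝ) * (C * B * D * (L / R) ^ p * A p) := by
        refine norm_sum_le_of_le _ fun i hi => ?_
        have hi : i ≤ p := by simpa [Nat.lt_succ_iff] using hi
        rw [norm_mul, norm_mul, Complex.norm_natCast, mul_assoc]
        refine mul_le_mul_of_nonneg_left ?_ (by positivity)
        calc ‖iteratedDeriv i h 0‖ * ‖iteratedDeriv (p - i) g 0‖
            ≤ (i.factorial * B / R ^ i) * (D * A (p - i) / R ^ (p - i)) :=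
              mul_le_mul (h1 i) (h2 _) (norm_nonneg _) (by positivity)
          _ ≤ ((C * L ^ i * A i) * B / R ^ i) * (D * A (p - i) / R ^ (p - i)) := by
              have := (hA (p - i)).le
              gcongr
              exact hfact i
          _ = C * B * D * (L ^ i / R ^ p) * (A i * A (p - i)) := by
              have : R ^ p = R ^ i * R ^ (p - i) := by rw [← pow_add]; congr 1; omega
              rw [this]; field_simp
          _ ≤ C * B * D * (L ^ p / R ^ p) * A p := by
              have h3 := hAmul i (p - i)
              rw [Nat.add_sub_cancel' hi] at h3
              have := (mul_pos (hA i) (hA (p - i))).le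
              gcongr
          _ = C * B * D * (L / R) ^ p * A p := by rw [div_pow]
    _ = _ := by
        rw [← Finset.sum_mul, ← Nat.cast_sum, Nat.sum_range_choose]
        push_cast
        simp only [div_pow, mul_pow]
        ring

/-- Directional derivatives of a function that is, along a line, the product of a holomorphic
function and a function with controlled directional derivatives. -/
lemma norm_dirD_iterate_le {d : ℕ} {A : ℕ → ℝ} (hA : ∀ p, 0 < A p)
    (hAmul : ∀ p q, A p * A q ≤ A (p + q)) {C L : ℝ} (hC : 0 ≤ C)
    (hL : 1 ≤ L) (hfact : ∀ p : ℕ, (p.factorial : ℝ) ≤ C * L ^ p * A p) {R B D : ℝ} (hR : 0 < R)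
    (hD : 0 ≤ D) {f g : Rd d → ℂ} (hf : ContDiff ℝ ∞ f) (hg : ContDiff ℝ ∞ g) {ξ v : Rd d}
    {H : ℂ → ℂ} (hH : DifferentiableOn ℂ H (Metric.ball 0 (2 * R)))
    (hHB : ∀ z, ‖z‖ ≤ R → ‖H z‖ ≤ B)
    (hfg : ∀ τ : ℝ, |τ| < R → f (ξ + τ • v) = H τ * g (ξ + τ • v))
    (h2 : ∀ q, ‖(dirD v)^[q] g ξ‖ ≤ D * A q / R ^ q) (p : ℕ) :
    ‖(dirD v)^[p] f ξ‖ ≤ C * B * D * (2 * L / R) ^ p * A p := by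
  have hB : 0 ≤ B := (norm_nonneg _).trans (hHB 0 (by simpa using hR.le))
  have e1 := iteratedDeriv_line hf ξ v p 0
  simp only [zero_smul, add_zero] at e1
  rw [← e1]
  have hev : (fun t : ℝ => f (ξ + t • v)) =ᶠ[nhds 0] fun t : ℝ => H t * g (ξ + t • v) := by
    have : ∀ᶠ t in nhds (0:ℝ), |t| < R :=
      (continuous_abs.isOpen_preimage _ isOpen_Iio).mem_nhds (by simpa using hR)
    filter_upwards [this] with t ht using hfg t ht
  rw [hev.iteratedDeriv_eq]
  refine norm_iteratedDeriv_mul_le hA hAmul hC hL hfact hR hB hD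
    (contDiffAt_comp_ofReal (by positivity) hH) ?_ (fun l => ?_) (fun q => ?_) p
  · exact (hg.comp (by fun_prop : ContDiff ℝ ∞ fun t : ℝ => ξ + t • v)).contDiffAt
  · have h3 := iteratedDeriv_comp_ofReal hH l 0 (by simpa using hR)
    rw [h3]
    have hsub : Metric.closedBall (0:ℂ) R ⊆ Metric.ball 0 (2 * R) :=
      Metric.closedBall_subset_ball (by linarith)
    have := Complex.norm_iteratedDeriv_le_of_forall_mem_sphere_norm_le (c := 0) (C := B) l hR
      ((hH.mono hsub).diffContOnCl_ball subset_rfl) (fun z hz => hHB z (by simpa using hz.le))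
    simpa using this
  · have := iteratedDeriv_line hg ξ v q 0
    simp only [zero_smul, add_zero] at this
    rw [this]; exact h2 q

/-- The weighted counting function `∑ w_n min(1, β_n t^{2k})`. -/
def countSum (w β : ℕ → ℝ) (k : ℕ) (t : ℝ) : ℝ := ∑' n, w n * min 1 (β n * t ^ (2 * k))

section countSum

variable {w β : ℕ → ℝ} {k : ℕ}

lemma min_one_nonneg (hβ : ∀ n, 0 < β n) (n : ℕ) (t : ℝ) : 0 ≤ min 1 (β n * t ^ (2 * k)) := by
  have := (hβ n).le
  have : 0 ≤ t ^ (2 * k) := by rw [pow_mul]; positivity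
  positivity

lemma summable_countSum (hβ : ∀ n, 0 < β n) (hs : Summable fun n : ℕ => ((n : ℝ) + 1) * β n)
    (hw0 : ∀ n, 0 ≤ w n) (hw : ∀ n : ℕ, w n ≤ n + 1) (t : ℝ) :
    Summable fun n => w n * min 1 (β n * t ^ (2 * k)) := by
  refine Summable.of_nonneg_of_le (fun n => mul_nonneg (hw0 n) (min_one_nonneg hβ n t)) (fun n => ?_)
    (hs.mul_right (t ^ (2 * k)))
  have : 0 ≤ t ^ (2 * k) := by rw [pow_mul]; positivity
  rw [mul_assoc]
  exact mul_le_mul (hw n) (min_le_right _ _) (min_one_nonneg hβ n t) (by positivity)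

lemma countSum_nonneg (hβ : ∀ n, 0 < β n) (hw0 : ∀ n, 0 ≤ w n) (t : ℝ) : 0 ≤ countSum w β k t :=
  tsum_nonneg fun n => mul_nonneg (hw0 n) (min_one_nonneg hβ n t)

lemma countSum_mono (hβ : ∀ n, 0 < β n) (hs : Summable fun n : ℕ => ((n : ℝ) + 1) * β n)
    (hw0 : ∀ n, 0 ≤ w n) (hw : ∀ n : ℕ, w n ≤ n + 1) {s t : ℝ} (h0 : 0 ≤ s) (hst : s ≤ t) :
    countSum w β k s ≤ countSum w β k t := by
  refine (summable_countSum hβ hs hw0 hw s).tsum_le_tsum (fun n => ?_) (summable_countSum hβ hs hw0 hw t)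
  have := (hβ n).le
  have := hw0 n
  gcongr

lemma one_le_add_one (n : ℕ) : (fun _ : ℕ => (1 : ℝ)) n ≤ n + 1 := by simp

/-- If the weights eventually exceed `m`, then `m` times the unweighted sum is dominated. -/
lemma mul_countSum_le (hβ : ∀ n, 0 < β n) (hs : Summable fun n : ℕ => ((n : ℝ) + 1) * β n)
    (hw0 : ∀ n, 0 ≤ w n) (hw : ∀ n : ℕ, w n ≤ n + 1) {m : ℝ} (hm : 0 ≤ m) {n₀ : ℕ}
    (h : ∀ n, n₀ ≤ n → m ≤ w n) (t : ℝ) :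
    m * countSum 1 β k t ≤ countSum w β k t + m * n₀ := by
  have hs1 := summable_countSum (k := k) hβ hs (w := 1) (fun _ => zero_le_one) one_le_add_one t
  have hs2 := summable_countSum (k := k) hβ hs hw0 hw t
  have hf : HasSum (fun n => if n < n₀ then m else 0) (m * n₀) := by
    have : HasSum (fun n => if n < n₀ then m else 0) (∑ n ∈ Finset.range n₀, if n < n₀ then m else 0) :=
      hasSum_sum_of_ne_finset_zero (fun n hn => by simp at hn; simp [hn])
    convert this using 1
    rw [Finset.sum_congr rfl (fun n hn => if_pos (Finset.mem_range.1 hn))]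
    simp [mul_comm]
  rw [countSum, ← tsum_mul_left, countSum, ← hf.tsum_eq, ← hs2.tsum_add hf.summable]
  refine (hs1.mul_left m).tsum_le_tsum (fun n => ?_) (hs2.add hf.summable)
  have h0 := min_one_nonneg (k := k) hβ n t
  have h1 : min 1 (β n * t ^ (2 * k)) ≤ 1 := min_le_left _ _
  simp only [Pi.one_apply, one_mul]
  split_ifs with hn
  · nlinarith [mul_nonneg (hw0 n) h0]
  · have := h n (by omega)
    nlinarith

lemma natCast_le_countSum (hβ : ∀ n, 0 < β n) (hs : Summable fun n : ℕ => ((n : ℝ) + 1) * β n)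
    {t : ℝ} {p : ℕ} (h : ∀ n, n < p → 1 ≤ β n * t ^ (2 * k)) : p ≤ countSum 1 β k t := by
  have hs1 := summable_countSum (k := k) hβ hs (w := 1) (fun _ => zero_le_one) one_le_add_one t
  refine le_trans ?_ (hs1.sum_le_tsum (Finset.range p) (fun n _ => ?_))
  · rw [Finset.sum_congr rfl (g := fun _ => (1 : ℝ))]
    · simp
    · intro n hn
      simp [min_eq_left (h n (Finset.mem_range.1 hn))]
  · simpa using min_one_nonneg (k := k) hβ n t

lemma exists_le_countSum (hβ : ∀ n, 0 < β n) (hs : Summable fun n : ℕ => ((n : ℝ) + 1) * β n)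
    (hk : 1 ≤ k) (y : ℝ) : ∃ T, 0 ≤ T ∧ ∀ t, T ≤ t → y ≤ countSum 1 β k t := by
  obtain ⟨p, hp⟩ := exists_nat_ge y
  have hp' : (0 : ℝ) ≤ ∑ n ∈ Finset.range p, (β n)⁻¹ :=
    Finset.sum_nonneg fun n _ => (inv_pos.2 (hβ n)).le
  refine ⟨1 + ∑ n ∈ Finset.range p, (β n)⁻¹, by positivity, fun t ht => hp.trans ?_⟩
  refine natCast_le_countSum hβ hs fun n hn => ?_
  have h1 : (β n)⁻¹ ≤ ∑ n ∈ Finset.range p, (β n)⁻¹ :=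
    Finset.single_le_sum (f := fun n => (β n)⁻¹) (fun n _ => (inv_pos.2 (hβ n)).le)
      (Finset.mem_range.2 hn)
  have h2 : 1 ≤ t := by linarith
  have h3 : (β n)⁻¹ ≤ t ^ (2 * k) :=
    le_trans (by linarith) (le_self_pow₀ h2 (by omega))
  calc (1 : ℝ) = β n * (β n)⁻¹ := (mul_inv_cancel₀ (hβ n).ne').symm
    _ ≤ _ := mul_le_mul_of_nonneg_left h3 (hβ n).le

/-- Diagonal choice of weights: a family of bounds `E R K * exp (-K W)` can be improved to
a bound by `exp (-K Φ)` with weights tending to infinity. -/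
lemma exists_diagonal_weights (hβ : ∀ n, 0 < β n)
    (hs : Summable fun n : ℕ => ((n : ℝ) + 1) * β n) (hk : 1 ≤ k) (E : ℕ → ℕ → ℝ) :
    ∃ w : ℕ → ℝ, (∀ n, 0 ≤ w n) ∧ (∀ n : ℕ, w n ≤ n + 1) ∧
      (∀ m : ℝ, 0 ≤ m → ∃ C, ∀ t, m * countSum 1 β k t ≤ countSum w β k t + C) ∧
      ∀ (R : ℕ) (K : ℝ), 0 ≤ K → ∃ C, 0 < C ∧ ∀ t, 0 ≤ t → ∃ K' : ℕ,
        E R K' * Real.exp (-(K' * countSum 1 β k t)) ≤ C * Real.exp (-(K * countSum w β k t)) := by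
  have hthr : ∀ i : ℕ, ∃ T, (i : ℝ) ≤ T ∧ ∀ t, T ≤ t → ∀ R ≤ i,
      E R ((i + 1) ^ 2) ≤ Real.exp (countSum 1 β k t) := by
    intro i
    obtain ⟨T, hT0, hT⟩ := exists_le_countSum hβ hs hk
      (∑ R ∈ Finset.range (i + 1), |E R ((i + 1) ^ 2)|)
    refine ⟨max T i, le_max_right _ _, fun t ht R hR => ?_⟩
    have h1 : |E R ((i + 1) ^ 2)| ≤ ∑ R ∈ Finset.range (i + 1), |E R ((i + 1) ^ 2)| :=
      Finset.single_le_sum (f := fun R => |E R ((i + 1) ^ 2)|) (fun _ _ => abs_nonneg _)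
        (Finset.mem_range.2 (by omega))
    have h2 := hT t ((le_max_left _ _).trans ht)
    have h3 := Real.add_one_le_exp (countSum 1 β k t)
    linarith [le_abs_self (E R ((i + 1) ^ 2))]
  choose T hTi hT using hthr
  have htail : ∀ i : ℕ, ∃ J : ℕ, ∑' n, (((n + J : ℕ) : ℝ) + 1) * β (n + J) * T i ^ (2 * k) ≤ 1 := by
    intro i
    have h1 := tendsto_sum_nat_add (fun n : ℕ => ((n : ℝ) + 1) * β n * T i ^ (2 * k))
    have h2 := (h1.eventually (ge_mem_nhds zero_lt_one)).exists
    exact h2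
  choose J hJ using htail
  let J' : ℕ → ℕ := fun i => if i = 0 then 0 else J i
  let w : ℕ → ℕ := fun n => Nat.findGreatest (fun i => ∀ j ≤ i, J' j ≤ n) n
  have hwn : ∀ n, w n ≤ n := fun n => Nat.findGreatest_le n
  have hw0 : ∀ n, (0 : ℝ) ≤ (fun n => (w n : ℝ)) n := fun n => Nat.cast_nonneg _
  have hw1 : ∀ n : ℕ, (fun n => (w n : ℝ)) n ≤ n + 1 := fun n => by
    have : (w n : ℝ) ≤ n := by exact_mod_cast hwn n
    simp only; linarith
  have hwJ : ∀ n i, n < J (i + 1) → w n ≤ i := by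
    intro n i hn
    by_contra hlt
    have h0 : (fun i => ∀ j ≤ i, J' j ≤ n) 0 := by
      intro j hj
      simp [J', Nat.le_zero.1 hj]
    have := Nat.findGreatest_spec (P := fun i => ∀ j ≤ i, J' j ≤ n) (Nat.zero_le n) h0 (i + 1)
      (by simp only [w] at hlt; omega)
    simp [J'] at this
    omega
  have hwlarge : ∀ m : ℕ, ∃ n₀, ∀ n, n₀ ≤ n → m ≤ w n := by
    intro m
    refine ⟨m + ∑ j ∈ Finset.range (m + 1), J' j, fun n hn => ?_⟩
    refine Nat.le_findGreatest (by omega) (fun j hj => ?_)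
    have : J' j ≤ ∑ j ∈ Finset.range (m + 1), J' j :=
      Finset.single_le_sum (fun _ _ => Nat.zero_le _) (Finset.mem_range.2 (by omega))
    omega
  have hs1 := fun t => summable_countSum (k := k) hβ hs (w := 1) (fun _ => zero_le_one)
    one_le_add_one t
  have hΦ : ∀ i t, 0 ≤ t → t ≤ T (i + 1) →
      countSum (fun n => (w n : ℝ)) β k t ≤ i * countSum 1 β k t + 1 := by
    intro i t ht0 ht
    set g : ℕ → ℝ := fun n => ((n : ℝ) + 1) * β n * T (i + 1) ^ (2 * k) with hg
    have hT0 : (0 : ℝ) ≤ T (i + 1) := ht0.trans ht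
    have hg0 : ∀ n, 0 ≤ g n := fun n => by have := (hβ n).le; positivity
    have hgs : Summable g := hs.mul_right _
    have hgs' : Summable fun n => if n < J (i + 1) then 0 else g n :=
      Summable.of_nonneg_of_le (fun n => by split_ifs <;> simp [hg0])
        (fun n => by split_ifs <;> simp [hg0]) hgs
    have hsum : ∑' n, (if n < J (i + 1) then 0 else g n) ≤ 1 := by
      rw [← hgs'.sum_add_tsum_nat_add (J (i + 1)), Finset.sum_eq_zero, zero_add]
      · simpa [hg] using hJ (i + 1)
      · intro n hn; simp [Finset.mem_range.1 hn]
    refine le_trans ?_ (add_le_add_right hsum _)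
    rw [countSum, countSum, ← tsum_mul_left, ← ((hs1 t).mul_left (i : ℝ)).tsum_add hgs']
    refine (summable_countSum hβ hs hw0 hw1 t).tsum_le_tsum (fun n => ?_)
      (((hs1 t).mul_left (i : ℝ)).add hgs')
    have h0 := min_one_nonneg (k := k) hβ n t
    simp only [Pi.one_apply, one_mul]
    split_ifs with hn
    · have : (w n : ℝ) ≤ i := by exact_mod_cast hwJ n i hn
      nlinarith
    · have h2 : (w n : ℝ) * min 1 (β n * t ^ (2 * k)) ≤ g n := by
        rw [hg]; simp only; rw [mul_assoc]
        refine mul_le_mul (hw1 n) ((min_le_right _ _).trans ?_) h0 (by positivity)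
        have := (hβ n).le
        gcongr
      have : 0 ≤ (i : ℝ) * min 1 (β n * t ^ (2 * k)) := by positivity
      linarith
  refine ⟨fun n => w n, hw0, hw1, fun m hm => ?_, fun R K hK => ?_⟩
  · obtain ⟨m', hm'⟩ := exists_nat_ge m
    obtain ⟨n₀, hn₀⟩ := hwlarge m'
    exact ⟨m * n₀, fun t => mul_countSum_le hβ hs hw0 hw1 hm
      (fun n hn => hm'.trans (by exact_mod_cast hn₀ n hn)) t⟩
  · obtain ⟨K₀, hK₀⟩ := exists_nat_ge K
    set i₀ := max R K₀ with hi₀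
    set C := Real.exp K + |E R 0| * Real.exp (K * countSum (fun n => (w n : ℝ)) β k (T i₀))
    have hC : 0 < C := by positivity
    refine ⟨C, hC, fun t ht => ?_⟩
    rcases lt_or_ge t (T i₀) with hlt | hge
    · refine ⟨0, ?_⟩
      have h1 := countSum_mono (k := k) hβ hs hw0 hw1 ht hlt.le
      simp only [Nat.cast_zero, zero_mul, neg_zero, Real.exp_zero, mul_one]
      rw [Real.exp_neg, ← div_eq_mul_inv, le_div_iff₀ (Real.exp_pos _)]
      calc E R 0 * Real.exp (K * countSum (fun n => (w n : ℝ)) β k t)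
          ≤ |E R 0| * Real.exp (K * countSum (fun n => (w n : ℝ)) β k (T i₀)) := by
            gcongr
            exact le_abs_self _
        _ ≤ C := le_add_of_nonneg_left (Real.exp_pos _).le
    · have hex : ∃ j, i₀ < j ∧ t < T j := by
        obtain ⟨j, hj⟩ := exists_nat_gt t
        refine ⟨max j (i₀ + 1), by omega, hj.trans_le (le_trans ?_ (hTi _))⟩
        exact_mod_cast le_max_left _ _
      classical
      obtain ⟨hj1, hj2⟩ := Nat.find_spec hex
      obtain ⟨i, hi⟩ : ∃ i, Nat.find hex = i + 1 := ⟨Nat.find hex - 1, by omega⟩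
      rw [hi] at hj1 hj2
      have hti : T i ≤ t := by
        rcases eq_or_lt_of_le (Nat.lt_succ_iff.1 hj1) with h | h
        · exact h ▸ hge
        · by_contra hcon
          exact Nat.find_min hex (m := i) (by omega) ⟨h, not_le.1 hcon⟩
      refine ⟨(i + 1) ^ 2, ?_⟩
      have h1 := hT i t hti R (by omega)
      have h2 := hΦ i t ht hj2.le
      have h3 := countSum_nonneg (k := k) hβ (w := 1) (fun _ => zero_le_one) t
      have hiK : K ≤ i := hK₀.trans (by exact_mod_cast (le_max_right _ _).trans (Nat.lt_succ_iff.1 hj1))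
      calc E R ((i + 1) ^ 2) * Real.exp (-(((i + 1) ^ 2 : ℕ) * countSum 1 β k t))
          ≤ Real.exp (countSum 1 β k t) * Real.exp (-(((i + 1) ^ 2 : ℕ) * countSum 1 β k t)) := by
            gcongr
        _ ≤ Real.exp K * Real.exp (-(K * countSum (fun n => (w n : ℝ)) β k t)) := by
            rw [← Real.exp_add, ← Real.exp_add]
            refine Real.exp_le_exp.2 ?_
            push_cast
            have h4 := mul_le_mul_of_nonneg_left h2 hK
            have h5 : K * i * countSum 1 β k t ≤ i * i * countSum 1 β k t := by gcongr
            have h6 : 0 ≤ i * countSum 1 β k t := by positivity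
            nlinarith
        _ ≤ _ := by
            gcongr
            exact le_add_of_nonneg_right (by positivity)

end countSum

namespace IsWeightSeq

variable {M : ℕ → ℝ}

lemma exists_quot_growth (hM : IsWeightSeq M) (h : M2star M) :
    ∃ p₀ N : ℕ, 1 ≤ p₀ ∧ 2 ≤ N ∧ ∀ i p, p₀ ≤ p → 2 ^ i * quot M p ≤ quot M (N ^ i * p) := by
  obtain ⟨p₀, N, hp₀, hN, h⟩ := h
  change ∀ p, p₀ ≤ p → 2 * quot M p ≤ quot M (N * p) at h
  refine ⟨p₀, N, hp₀, ?_, fun i p hp => ?_⟩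
  · by_contra hlt
    obtain rfl : N = 1 := by omega
    have h1 := h p₀ le_rfl
    have h2 := hM.quot_pos p₀
    rw [one_mul] at h1
    linarith
  · induction i with
    | zero => simp
    | succ i ih =>
      have h1 := h (N ^ i * p) (hp.trans (Nat.le_mul_of_pos_left _ (by positivity)))
      calc 2 ^ (i + 1) * quot M p = 2 * (2 ^ i * quot M p) := by ring
        _ ≤ 2 * quot M (N ^ i * p) := by gcongr
        _ ≤ quot M (N * (N ^ i * p)) := h1
        _ = _ := by congr 1; ring

lemma quot_ratio_le (hM : IsWeightSeq M) {p₀ N k : ℕ} (hp₀ : 1 ≤ p₀) (hN : 2 ≤ N)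
    (h : ∀ i p, p₀ ≤ p → 2 ^ i * quot M p ≤ quot M (N ^ i * p)) (hk : N ^ 3 ≤ 4 ^ k) {n p : ℕ}
    (hp : p₀ ≤ p) (hn : p ≤ n) :
    (quot M p / quot M n) ^ (2 * k) ≤ ((N : ℝ) * p / n) ^ 3 := by
  have hex : ∃ i, n < N ^ (i + 1) * p :=
    ⟨n, (Nat.lt_pow_self (by omega : 1 < N)).trans_le
      ((Nat.pow_le_pow_right (by omega) (Nat.le_succ n)).trans
        (Nat.le_mul_of_pos_right _ (by omega)))⟩
  classical
  obtain ⟨i, hi, hmin⟩ : ∃ i, n < N ^ (i + 1) * p ∧ N ^ i * p ≤ n := by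
    refine ⟨Nat.find hex, Nat.find_spec hex, ?_⟩
    rcases Nat.eq_zero_or_pos (Nat.find hex) with h0 | h0
    · rw [h0]; simpa using hn
    · have := Nat.find_min hex (m := Nat.find hex - 1) (by omega)
      rw [Nat.sub_add_cancel h0] at this
      omega
  have h1 : 2 ^ i * quot M p ≤ quot M n := (h i p hp).trans (hM.quot_mono hmin)
  have hq := hM.quot_pos p
  have hqn := hM.quot_pos n
  have hn0 : (0 : ℝ) < n := by exact_mod_cast (by omega : 0 < n)
  have hN0 : (0 : ℝ) < N := by exact_mod_cast (by omega : 0 < N)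
  have h2 : quot M p / quot M n ≤ (2 ^ i)⁻¹ := by
    rw [div_le_iff₀ hqn, ← div_eq_inv_mul, le_div_iff₀ (by positivity)]
    linarith
  have h3 : ((N : ℝ) ^ i)⁻¹ ≤ N * p / n := by
    rw [inv_le_comm₀ (by positivity) (by
      have : (0 : ℝ) < p := by exact_mod_cast (by omega : 0 < p)
      positivity), inv_div, div_le_iff₀ (by
      have : (0 : ℝ) < p := by exact_mod_cast (by omega : 0 < p)
      positivity)]
    have : (n : ℝ) ≤ N ^ (i + 1) * p := by exact_mod_cast hi.le
    calc (n : ℝ) ≤ N ^ (i + 1) * p := this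
      _ = _ := by ring
  calc (quot M p / quot M n) ^ (2 * k) ≤ ((2 ^ i)⁻¹) ^ (2 * k) := by gcongr
    _ = (((4 : ℝ) ^ k)⁻¹) ^ i := by
      rw [inv_pow, inv_pow, ← pow_mul, ← pow_mul, show (4 : ℝ) = 2 ^ 2 by norm_num, ← pow_mul]
      congr 2; ring
    _ ≤ (((N : ℝ) ^ 3)⁻¹) ^ i := by
      gcongr
      exact_mod_cast hk
    _ = (((N : ℝ) ^ i)⁻¹) ^ 3 := by
      rw [inv_pow, inv_pow, ← pow_mul, ← pow_mul, mul_comm]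
    _ ≤ _ := by gcongr

lemma exists_counting_index (hM : IsWeightSeq M) {p₀ N : ℕ}
    (h : ∀ i p, p₀ ≤ p → 2 ^ i * quot M p ≤ quot M (N ^ i * p)) (t : ℝ) :
    ∃ p : ℕ, (∀ n, n < p → quot M n ≤ t) ∧ ∀ n, p ≤ n → t < quot M n := by
  have hex : ∃ p, t < quot M p := by
    obtain ⟨i, hi⟩ := pow_unbounded_of_one_lt t (one_lt_two)
    refine ⟨N ^ i * p₀, hi.trans_le (le_trans ?_ (h i p₀ le_rfl))⟩
    exact le_mul_of_one_le_right (by positivity) (hM.one_le_quot _)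
  classical
  exact ⟨Nat.find hex, fun n hn => not_lt.1 (Nat.find_min hex hn),
    fun n hn => (Nat.find_spec hex).trans_le (hM.quot_mono hn)⟩

/-- The maximum of `s^a / M_a` is attained at the counting index. -/
lemma pow_mul_le_pow_mul (hM : IsWeightSeq M) {s : ℝ} (hs : 0 ≤ s) {Q : ℕ}
    (h1 : ∀ j, 1 ≤ j → j ≤ Q → quot M j ≤ s) (h2 : ∀ j, Q < j → s ≤ quot M j) (a : ℕ) :
    s ^ a * M Q ≤ s ^ Q * M a := by
  rcases le_total Q a with h | h
  · induction a, h using Nat.le_induction with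
    | base => rfl
    | succ a ha ih =>
      rw [hM.succ_eq, pow_succ]
      have := h2 (a + 1) (by omega)
      calc s ^ a * s * M Q = s ^ a * M Q * s := by ring
        _ ≤ s ^ Q * M a * quot M (a + 1) :=
          mul_le_mul ih this hs (mul_nonneg (by positivity) (hM.pos _).le)
        _ = _ := by ring
  · have key : ∀ b, b ≤ Q → s ^ (Q - b) * M Q ≤ s ^ Q * M (Q - b) := by
      intro b
      induction b with
      | zero => simp
      | succ b ih =>
        intro hb
        have h3 := ih (by omega)
        have h4 : Q - b = (Q - (b + 1)) + 1 := by omega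
        have h5 := h1 (Q - b) (by omega) (by omega)
        rw [h4] at h3 h5
        rw [hM.succ_eq, pow_succ] at h3
        set e := Q - (b + 1)
        have hq := hM.quot_pos (e + 1)
        have hMe := hM.pos e
        have hs0 : 0 < s := hq.trans_le h5
        have h6 : s ^ Q * (M e * quot M (e + 1)) ≤ s ^ Q * (M e * s) := by gcongr
        have h7 : s ^ e * M Q * s ≤ s ^ Q * M e * s := by nlinarith
        exact le_of_mul_le_mul_right h7 hs0
    have := key (Q - a) (by omega)
    rwa [Nat.sub_sub_self h] at this

lemma pow_le_of_counting (hM : IsWeightSeq M) {C₀ H : ℝ} (h2 : HasM2 M C₀ H) {s : ℝ} (hs : 0 ≤ s)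
    {P : ℕ} (hP1 : ∀ n, n < P → quot M n ≤ s) (hP2 : ∀ n, P ≤ n → s < quot M n) (a : ℕ) :
    s ^ a ≤ C₀ * H ^ (2 * P) * M a := by
  obtain ⟨hC, hH, h2⟩ := h2
  set Q := P - 1 with hQ
  have key := hM.pow_mul_le_pow_mul (Q := Q) hs (fun j _ hj => hP1 j (by omega))
    (fun j hj => (hP2 j (by omega)).le)
  have hQP : H ^ (2 * Q) ≤ H ^ (2 * P) := pow_le_pow_right₀ hH (by omega)
  have hMa := hM.pos a
  have hMQ := hM.pos Q
  have hsQ : s ^ Q ≤ C₀ * H ^ (2 * Q) * M Q := by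
    rcases Nat.eq_zero_or_pos Q with h0 | h0
    · rw [h0]; simpa [hM.2.1] using hC
    · have hs1 : 1 ≤ s := (hM.one_le_quot 0).trans (hP1 0 (by omega))
      have h3 := key (Q + Q)
      have h4 := h2 Q Q
      have h5 : s ^ Q * M (Q + Q) ≤ s ^ Q * (C₀ * H ^ (Q + Q) * M Q * M Q) := by gcongr
      have h6 : s ^ Q * (s ^ Q * M Q) ≤ s ^ Q * (C₀ * H ^ (Q + Q) * M Q * M Q) := by
        rw [← mul_assoc, ← pow_add]; exact h3.trans h5
      have h7 := le_of_mul_le_mul_left h6 (by positivity)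
      rw [two_mul]
      exact le_of_mul_le_mul_right h7 hMQ
  have h8 : s ^ a * M Q ≤ C₀ * H ^ (2 * P) * M a * M Q := by
    calc s ^ a * M Q ≤ s ^ Q * M a := key a
      _ ≤ (C₀ * H ^ (2 * Q) * M Q) * M a := by gcongr
      _ ≤ (C₀ * H ^ (2 * P) * M Q) * M a := by gcongr
      _ = _ := by ring
  exact le_of_mul_le_mul_right h8 hMQ

lemma le_pow_of_counting (hM : IsWeightSeq M) {t : ℝ}
    {a : ℕ} (h : ∀ n, n ≤ a → 1 ≤ n → quot M n ≤ t) : M a ≤ t ^ a := by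
  induction a with
  | zero => simp [hM.2.1]
  | succ a ih =>
    rw [hM.succ_eq, pow_succ]
    have h1 := ih fun n hn => h n (by omega)
    have h2 := h (a + 1) le_rfl (by omega)
    exact mul_le_mul h1 h2 (hM.quot_pos _).le ((hM.pos a).le.trans h1)

end IsWeightSeq

lemma sum_telescope_le {a : ℝ} (ha : 1 ≤ a) {f : ℕ → ℝ}
    (hf : ∀ n : ℕ, f n ≤ 6 * a ^ 2 / ((n + a) * (n + 1 + a))) (m : ℕ) :
    ∑ n ∈ Finset.range m, f n ≤ 6 * a := by
  have h1 : ∀ n : ℕ, 6 * a ^ 2 / ((n + a) * (n + 1 + a)) =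
      (fun n : ℕ => 6 * a ^ 2 / (n + a)) n - (fun n : ℕ => 6 * a ^ 2 / (n + a)) (n + 1) := by
    intro n
    have : (0 : ℝ) < n + a := by positivity
    have : (0 : ℝ) < n + 1 + a := by positivity
    simp only [Nat.cast_add, Nat.cast_one]
    field_simp
    ring
  calc ∑ n ∈ Finset.range m, f n ≤ ∑ n ∈ Finset.range m, 6 * a ^ 2 / ((n + a) * (n + 1 + a)) :=
        Finset.sum_le_sum fun n _ => hf n
    _ = 6 * a ^ 2 / ((0 : ℕ) + a) - 6 * a ^ 2 / (m + a) := by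
        rw [Finset.sum_congr rfl (fun n _ => h1 n), Finset.sum_range_sub']
    _ ≤ 6 * a ^ 2 / ((0 : ℕ) + a) := by
        have : 0 ≤ 6 * a ^ 2 / (m + a) := by positivity
        linarith
    _ = 6 * a := by
        simp only [Nat.cast_zero, zero_add]; field_simp

lemma countSum_le_of_counting {β : ℕ → ℝ} {k : ℕ} (hβ : ∀ n, 0 < β n) {t : ℝ} {p N : ℕ}
    (hp : 1 ≤ p) (hN : 1 ≤ N)
    (h : ∀ n, p ≤ n → β n * t ^ (2 * k) ≤ ((N : ℝ) * p / n) ^ 3) :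
    countSum 1 β k t ≤ 6 * (N * p) := by
  have hp' : (1 : ℝ) ≤ p := by exact_mod_cast hp
  have hN' : (1 : ℝ) ≤ N := by exact_mod_cast hN
  set a : ℝ := N * p with ha
  have hpa : (p : ℝ) ≤ a := by nlinarith
  have ha1 : 1 ≤ a := hp'.trans hpa
  refine Real.tsum_le_of_sum_range_le
    (fun n => by simpa using min_one_nonneg hβ n t) (sum_telescope_le ha1 fun n => ?_)
  simp only [Pi.one_apply, one_mul]
  have hn0 : (0 : ℝ) ≤ n := Nat.cast_nonneg n
  rcases le_total (n : ℝ) a with hna | hna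
  · refine (min_le_left _ _).trans ?_
    rw [le_div_iff₀ (by positivity)]
    nlinarith
  · have hpn : p ≤ n := by exact_mod_cast hpa.trans hna
    refine (min_le_right _ _).trans ((h n hpn).trans ?_)
    have hn1 : (0 : ℝ) < n := by linarith
    have hle : a / n ≤ 1 := (div_le_one hn1).2 hna
    have h0 : 0 ≤ a / n := by positivity
    calc (a / n) ^ 3 ≤ (a / n) ^ 2 := pow_le_pow_of_le_one h0 hle (by norm_num)
      _ = a ^ 2 / n ^ 2 := div_pow _ _ _
      _ ≤ _ := by
        rw [div_le_div_iff₀ (by positivity) (by positivity)]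
        have : (n + a) * (n + 1 + a) ≤ 6 * (n : ℝ) ^ 2 := by nlinarith
        calc a ^ 2 * ((n + a) * (n + 1 + a)) ≤ a ^ 2 * (6 * (n : ℝ) ^ 2) := by gcongr
          _ = _ := by ring

/-- Existence of exponents for which the counting sum controls the associated function. -/
theorem exists_countSum {M : ℕ → ℝ} (hM : IsWeightSeq M) (hM2 : M2 M) (h2s : M2star M) :
    ∃ (k : ℕ) (β : ℕ → ℝ), 1 ≤ k ∧ (∀ n, 0 < β n) ∧
      (Summable fun n : ℕ => ((n : ℝ) + 1) * β n) ∧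
      (∀ κ : ℝ, 0 ≤ κ → ∀ R : ℝ, 0 ≤ R → ∃ C, 0 ≤ C ∧ ∀ t, 0 ≤ t → ∀ a : ℕ,
        (κ * (t + R)) ^ a ≤ M a * Real.exp (C * countSum 1 β k t + C)) ∧
      ∀ K : ℝ, 0 ≤ K → ∃ κ C : ℝ, 1 ≤ κ ∧ 0 ≤ C ∧ ∀ t, 0 ≤ t → ∃ a : ℕ,
        M a * Real.exp (K * countSum 1 β k t) ≤ C * (κ * t) ^ a := by
  obtain ⟨p₀, N, hp₀, hN, hgr⟩ := hM.exists_quot_growth h2s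
  obtain ⟨C₀, H, hM2⟩ := hM2
  obtain ⟨hC₀, hH, -⟩ := id hM2
  obtain ⟨k, hk⟩ : ∃ k : ℕ, N ^ 3 ≤ 4 ^ k := ⟨N ^ 3, (Nat.lt_pow_self (by norm_num)).le⟩
  have hk1 : 1 ≤ k := by
    by_contra h0
    obtain rfl : k = 0 := by omega
    have : 2 ^ 3 ≤ N ^ 3 := Nat.pow_le_pow_left hN 3
    omega
  set β : ℕ → ℝ := fun n => (quot M n ^ (2 * k))⁻¹ with hβdef
  have hβ : ∀ n, 0 < β n := fun n => by have := hM.quot_pos n; positivity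
  have hratio : ∀ {n p : ℕ}, p₀ ≤ p → p ≤ n → ∀ t, 0 ≤ t → t ≤ quot M p →
      β n * t ^ (2 * k) ≤ ((N : ℝ) * p / n) ^ 3 := by
    intro n p hp hn t ht0 ht
    have := hM.quot_pos n
    calc β n * t ^ (2 * k) ≤ β n * quot M p ^ (2 * k) := by
          have := (hβ n).le; gcongr
      _ = (quot M p / quot M n) ^ (2 * k) := by rw [div_pow, hβdef]; field_simp
      _ ≤ _ := hM.quot_ratio_le hp₀ hN hgr hk hp hn
  have hs : Summable fun n : ℕ => ((n : ℝ) + 1) * β n := by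
    have h1 : Summable fun n : ℕ => 2 * ((N : ℝ) * p₀) ^ 3 * (1 / (n : ℝ) ^ 2) :=
      (Real.summable_one_div_nat_pow.2 (by norm_num)).mul_left _
    refine Summable.of_norm_bounded_eventually_nat h1 ?_
    filter_upwards [eventually_ge_atTop p₀] with n hn
    have hn1 : (1 : ℝ) ≤ n := by exact_mod_cast hp₀.trans hn
    have h2 := hratio le_rfl hn 1 zero_le_one (hM.one_le_quot _)
    rw [one_pow, mul_one] at h2
    rw [Real.norm_of_nonneg (by have := (hβ n).le; positivity)]
    calc ((n : ℝ) + 1) * β n ≤ (2 * n) * ((N : ℝ) * p₀ / n) ^ 3 := by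
          have := (hβ n).le
          gcongr
          linarith
      _ = _ := by field_simp
  have hlow : ∀ {t : ℝ} {p : ℕ}, (∀ n, n < p → quot M n ≤ t) → p ≤ countSum 1 β k t := by
    intro t p hp
    refine natCast_le_countSum hβ hs fun n hn => ?_
    have hq := hM.quot_pos n
    calc (1 : ℝ) = β n * quot M n ^ (2 * k) := by rw [hβdef]; field_simp
      _ ≤ _ := by have := (hβ n).le; have := hp n hn; gcongr
  have hA1 : ∀ κ : ℝ, 0 ≤ κ → ∃ C, 0 ≤ C ∧ ∀ t, 0 ≤ t → ∀ a : ℕ,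
      (κ * t) ^ a ≤ M a * Real.exp (C * countSum 1 β k t + C) := by
    intro κ hκ
    obtain ⟨i, hi⟩ := pow_unbounded_of_one_lt κ (one_lt_two)
    have hlogC := Real.log_nonneg hC₀
    have hlogH := Real.log_nonneg hH
    set B : ℝ := 2 * (N : ℝ) ^ i * Real.log H with hB
    have hB0 : 0 ≤ B := by positivity
    refine ⟨Real.log C₀ + B * (p₀ + 1), by positivity, fun t ht a => ?_⟩
    obtain ⟨p, hp1, hp2⟩ := hM.exists_counting_index hgr t
    obtain ⟨P, hP1, hP2⟩ := hM.exists_counting_index hgr (κ * t)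
    have hpW := hlow hp1
    have hPle : P ≤ N ^ i * (p + p₀) := by
      by_contra hcon
      have h1 := hP1 _ (not_le.1 hcon)
      have h2 := hgr i (p + p₀) (by omega)
      have h3 := hp2 (p + p₀) (by omega)
      have h4 : κ * t ≤ 2 ^ i * t := by gcongr
      have h5 : (2 : ℝ) ^ i * t < 2 ^ i * quot M (p + p₀) := by gcongr
      linarith
    have h6 := hM.pow_le_of_counting hM2 (mul_nonneg hκ ht) hP1 hP2 a
    have h7 : C₀ * H ^ (2 * P) = Real.exp (Real.log C₀ + (2 * P : ℕ) * Real.log H) := by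
      rw [Real.exp_add, Real.exp_log (by linarith), ← Real.log_pow,
        Real.exp_log (by positivity)]
    have hMa := (hM.pos a).le
    have hW := countSum_nonneg (k := k) hβ (w := 1) (fun _ => zero_le_one) t
    rw [mul_comm (M a)]
    refine h6.trans (mul_le_mul_of_nonneg_right ?_ hMa)
    rw [h7]
    refine Real.exp_le_exp.2 ?_
    have h8 : (P : ℝ) ≤ N ^ i * (p + p₀) := by exact_mod_cast hPle
    have h9 : ((2 * P : ℕ) : ℝ) * Real.log H ≤ B * (countSum 1 β k t + p₀) := by
      push_cast
      calc 2 * (P : ℝ) * Real.log H ≤ 2 * (N ^ i * (p + p₀)) * Real.log H := by gcongr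
        _ = B * (p + p₀) := by rw [hB]; ring
        _ ≤ _ := by gcongr
    have h10 : 0 ≤ Real.log C₀ * countSum 1 β k t := by positivity
    have h11 : 0 ≤ B * p₀ * countSum 1 β k t := by positivity
    nlinarith
  refine ⟨k, β, hk1, hβ, hs, fun κ hκ R hR => ?_, fun K hK => ?_⟩
  · obtain ⟨C, hC, h⟩ := hA1 (2 * κ) (by positivity)
    have hWR := countSum_nonneg (k := k) hβ (w := 1) (fun _ => zero_le_one) R
    refine ⟨C + C * countSum 1 β k R, by positivity, fun t ht a => ?_⟩
    have hWt := countSum_nonneg (k := k) hβ (w := 1) (fun _ => zero_le_one) t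
    have h1 := h (max t R) (le_max_of_le_left ht) a
    have hmax : countSum 1 β k (max t R) ≤ countSum 1 β k t + countSum 1 β k R := by
      rcases max_cases t R with ⟨h, _⟩ | ⟨h, _⟩ <;> rw [h] <;> linarith
    have hMa := (hM.pos a).le
    have h2 : κ * (t + R) ≤ 2 * κ * max t R := by
      have := le_max_left t R
      have := le_max_right t R
      nlinarith
    calc (κ * (t + R)) ^ a ≤ (2 * κ * max t R) ^ a := by gcongr
      _ ≤ _ := h1
      _ ≤ _ := by
        refine mul_le_mul_of_nonneg_left (Real.exp_le_exp.2 ?_) hMa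
        have h3 := mul_le_mul_of_nonneg_left hmax hC
        have h4 : 0 ≤ C * countSum 1 β k R * countSum 1 β k t := by positivity
        nlinarith
  · refine ⟨Real.exp (6 * N * K), Real.exp (6 * N * K * (p₀ + 1)),
      Real.one_le_exp (by positivity), (Real.exp_pos _).le, fun t ht => ?_⟩
    obtain ⟨p, hp1, hp2⟩ := hM.exists_counting_index hgr t
    refine ⟨p - 1, ?_⟩
    have h1 : countSum 1 β k t ≤ 6 * (N * ((p + p₀ : ℕ) : ℝ)) :=
      countSum_le_of_counting hβ (by omega) (by omega)
        fun n hn => hratio (by omega) hn t ht (hp2 _ (by omega)).le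
    have h2 : M (p - 1) ≤ t ^ (p - 1) := hM.le_pow_of_counting fun n hn h1n => hp1 n (by omega)
    have h3 : (p : ℝ) ≤ (p - 1 : ℕ) + 1 := by exact_mod_cast (by omega : p ≤ p - 1 + 1)
    rw [mul_pow, ← Real.exp_nat_mul, ← mul_assoc, ← Real.exp_add, mul_comm (M _)]
    refine mul_le_mul (Real.exp_le_exp.2 ?_) h2 (hM.pos _).le (Real.exp_pos _).le
    calc K * countSum 1 β k t ≤ K * (6 * (N * ((p + p₀ : ℕ) : ℝ))) := by gcongr
      _ = 6 * N * K * (p + p₀) := by push_cast; ring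
      _ ≤ 6 * N * K * (((p - 1 : ℕ) + 1) + p₀) := by gcongr
      _ = _ := by ring

/-- The entire function `∑ w_n (1 - exp (-β_n X^k))`. -/
def expSum (w β : ℕ → ℝ) (k : ℕ) (X : ℂ) : ℂ := ∑' n, (w n : ℂ) * (1 - Complex.exp (-(β n * X ^ k)))

lemma norm_one_sub_exp_neg_le {Y : ℂ} {c : ℝ} (hc : 0 ≤ c) (h : -c ≤ Y.re) :
    ‖1 - Complex.exp (-Y)‖ ≤ 2 * Real.exp c * min 1 ‖Y‖ := by
  have h1 : 1 ≤ Real.exp c := Real.one_le_exp hc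
  rcases le_total ‖Y‖ 1 with hY | hY
  · rw [min_eq_right hY, norm_sub_rev]
    have := Complex.norm_exp_sub_one_le (x := -Y) (by rwa [norm_neg])
    rw [norm_neg] at this
    nlinarith [norm_nonneg Y]
  · rw [min_eq_left hY, mul_one]
    refine (norm_sub_le _ _).trans ?_
    rw [norm_one, Complex.norm_exp, Complex.neg_re]
    have : Real.exp (-Y.re) ≤ Real.exp c := Real.exp_le_exp.2 (by linarith)
    linarith

lemma quarter_min_le {y : ℝ} (hy : 0 ≤ y) : min 1 y / 4 ≤ 1 - Real.exp (-(y / 2)) := by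
  have h1 : Real.exp (-(y / 2)) ≤ (1 + y / 2)⁻¹ := by
    rw [Real.exp_neg]
    refine inv_anti₀ (by positivity) ?_
    linarith [Real.add_one_le_exp (y / 2)]
  have h2 : (1 + y / 2)⁻¹ ≤ 1 - min 1 y / 4 := by
    rw [inv_le_iff_one_le_mul₀ (by positivity)]
    rcases le_total 1 y with h | h
    · rw [min_eq_left h]; nlinarith
    · rw [min_eq_right h]; nlinarith
  linarith

lemma le_re_one_sub_exp_neg {Y : ℂ} {y c c' : ℝ} (hy : 0 ≤ y) (hc : 0 ≤ c) (hcc : c ≤ c')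
    (h : y / 2 - c ≤ Y.re) :
    min 1 y / 4 - c * Real.exp c' ≤ (1 - Complex.exp (-Y)).re := by
  have h1 : (Complex.exp (-Y)).re ≤ Real.exp (-(y / 2) + c) := by
    refine (Complex.re_le_norm _).trans ?_
    rw [Complex.norm_exp, Complex.neg_re]
    exact Real.exp_le_exp.2 (by linarith)
  have h2 := quarter_min_le hy
  have h3 : Real.exp (-(y / 2)) ≤ 1 := Real.exp_le_one_iff.2 (by linarith)
  have h4 : Real.exp c - 1 ≤ c * Real.exp c := by
    have := Real.add_one_le_exp (-c)
    have h5 : Real.exp (-c) * Real.exp c = 1 := by rw [← Real.exp_add]; simp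
    nlinarith [Real.exp_pos c]
  have h5 : c * Real.exp c ≤ c * Real.exp c' := by gcongr
  rw [Real.exp_add] at h1
  have h6 : 1 ≤ Real.exp c := Real.one_le_exp hc
  simp only [Complex.sub_re, Complex.one_re]
  nlinarith

section expSum

variable {w β : ℕ → ℝ} {k : ℕ}

lemma beta_le (hβ : ∀ n, 0 < β n) (hs : Summable fun n : ℕ => ((n : ℝ) + 1) * β n) (n : ℕ) :
    β n ≤ ∑' n : ℕ, ((n : ℝ) + 1) * β n := by
  refine le_trans ?_ (hs.le_tsum n (fun j _ => by have := (hβ j).le; positivity))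
  have := hβ n
  have : (0 : ℝ) ≤ n := Nat.cast_nonneg n
  nlinarith

lemma norm_expSum_term_le (hβ : ∀ n, 0 < β n) (hs : Summable fun n : ℕ => ((n : ℝ) + 1) * β n)
    (hw0 : ∀ n, 0 ≤ w n) (hw : ∀ n : ℕ, w n ≤ n + 1) {s C : ℝ} (hC : 0 ≤ C) {X : ℂ}
    (h1 : -C ≤ (X ^ k).re) (h2 : ‖X ^ k‖ ≤ 2 * s ^ (2 * k) + C) (n : ℕ) :
    ‖(w n : ℂ) * (1 - Complex.exp (-(β n * X ^ k)))‖ ≤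
      2 * Real.exp ((∑' n : ℕ, ((n : ℝ) + 1) * β n) * C) *
        (2 * (w n * min 1 (β n * s ^ (2 * k))) + C * (((n : ℝ) + 1) * β n)) := by
  set b := ∑' n : ℕ, ((n : ℝ) + 1) * β n
  have hb := beta_le hβ hs n
  have hb0 := hβ n
  have hwn := hw0 n
  have hs0 : 0 ≤ s ^ (2 * k) := by rw [pow_mul]; positivity
  have h3 : -(b * C) ≤ ((β n : ℂ) * X ^ k).re := by
    rw [Complex.re_ofReal_mul]
    nlinarith
  have h4 := norm_one_sub_exp_neg_le (mul_nonneg (hb0.le.trans hb) hC) h3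
  rw [norm_mul, Complex.norm_real, Real.norm_of_nonneg hb0.le] at h4
  rw [norm_mul, Complex.norm_real, Real.norm_of_nonneg hwn]
  have h5 : min 1 (β n * ‖X ^ k‖) ≤ 2 * min 1 (β n * s ^ (2 * k)) + C * β n := by
    have h6 : β n * ‖X ^ k‖ ≤ 2 * (β n * s ^ (2 * k)) + C * β n := by nlinarith
    have h7 : 0 ≤ C * β n := by positivity
    rcases le_total 1 (β n * s ^ (2 * k)) with h | h
    · rw [min_eq_left h]
      have := min_le_left 1 (β n * ‖X ^ k‖)
      linarith
    · rw [min_eq_right h]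
      exact (min_le_right _ _).trans h6
  have h8 : w n * (C * β n) ≤ C * (((n : ℝ) + 1) * β n) := by
    have := mul_le_mul_of_nonneg_right (hw n) (mul_nonneg hC hb0.le)
    linarith
  calc w n * ‖1 - Complex.exp (-(β n * X ^ k))‖
      ≤ w n * (2 * Real.exp (b * C) * (2 * min 1 (β n * s ^ (2 * k)) + C * β n)) := by
        gcongr
        refine h4.trans ?_
        gcongr
    _ = 2 * Real.exp (b * C) * (2 * (w n * min 1 (β n * s ^ (2 * k))) + w n * (C * β n)) := by ring
    _ ≤ _ := by gcongr

lemma norm_expSum_term_le_of_norm_le (hβ : ∀ n, 0 < β n)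
    (hs : Summable fun n : ℕ => ((n : ℝ) + 1) * β n) (hk : 1 ≤ k)
    (hw0 : ∀ n, 0 ≤ w n) (hw : ∀ n : ℕ, w n ≤ n + 1) {r : ℝ} (hr : 0 ≤ r) {X : ℂ}
    (h : ‖X‖ ≤ r) (n : ℕ) :
    ‖(w n : ℂ) * (1 - Complex.exp (-(β n * X ^ k)))‖ ≤
      2 * Real.exp ((∑' n : ℕ, ((n : ℝ) + 1) * β n) * r ^ k) *
        (r ^ k * (((n : ℝ) + 1) * β n)) := by
  have h1 : ‖X ^ k‖ ≤ r ^ k := by rw [norm_pow]; gcongr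
  have := norm_expSum_term_le hβ hs hw0 hw (s := 0) (C := r ^ k) (by positivity) (X := X)
    (by linarith [neg_le_of_abs_le (Complex.abs_re_le_norm (X ^ k))])
    (h1.trans (by simp)) n
  rwa [zero_pow (by omega), mul_zero, min_eq_right zero_le_one, mul_zero, mul_zero, zero_add] at this

lemma summable_expSum (hβ : ∀ n, 0 < β n) (hs : Summable fun n : ℕ => ((n : ℝ) + 1) * β n)
    (hk : 1 ≤ k) (hw0 : ∀ n, 0 ≤ w n) (hw : ∀ n : ℕ, w n ≤ n + 1) (X : ℂ) :
    Summable fun n => (w n : ℂ) * (1 - Complex.exp (-(β n * X ^ k))) :=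
  Summable.of_norm_bounded ((hs.mul_left _).mul_left _)
    (norm_expSum_term_le_of_norm_le hβ hs hk hw0 hw (norm_nonneg X) le_rfl)

lemma differentiable_expSum (hβ : ∀ n, 0 < β n) (hs : Summable fun n : ℕ => ((n : ℝ) + 1) * β n)
    (hk : 1 ≤ k) (hw0 : ∀ n, 0 ≤ w n) (hw : ∀ n : ℕ, w n ≤ n + 1) :
    Differentiable ℂ (expSum w β k) := by
  intro X
  have hr : 0 ≤ ‖X‖ + 1 := by positivity
  have hd : DifferentiableOn ℂ (expSum w β k) (Metric.ball 0 (‖X‖ + 1)) := by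
    refine Complex.differentiableOn_tsum_of_summable_norm ((hs.mul_left ((‖X‖ + 1) ^ k)).mul_left _)
      (fun n => ?_) Metric.isOpen_ball
      (fun n Y hY => norm_expSum_term_le_of_norm_le hβ hs hk hw0 hw hr
        (by simpa using (mem_ball_zero_iff.1 hY).le) n)
    fun_prop
  exact hd.differentiableAt (Metric.isOpen_ball.mem_nhds (by simp))

lemma norm_pow_sub_pow_le {a b : ℂ} {δ : ℝ} (h : ‖a - b‖ ≤ δ) (k : ℕ) :
    ‖a ^ k - b ^ k‖ ≤ (‖b‖ + δ) ^ k - ‖b‖ ^ k := by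
  have hδ : 0 ≤ δ := (norm_nonneg _).trans h
  have ha : ‖a‖ ≤ ‖b‖ + δ := by
    calc ‖a‖ = ‖b + (a - b)‖ := by congr 1; ring
      _ ≤ _ := (norm_add_le _ _).trans (by gcongr)
  induction k with
  | zero => simp
  | succ k ih =>
    calc ‖a ^ (k + 1) - b ^ (k + 1)‖ = ‖a ^ k * (a - b) + (a ^ k - b ^ k) * b‖ := by congr 1; ring
      _ ≤ ‖a‖ ^ k * ‖a - b‖ + ‖a ^ k - b ^ k‖ * ‖b‖ := by
        refine (norm_add_le _ _).trans ?_
        rw [norm_mul, norm_mul, norm_pow]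
      _ ≤ (‖b‖ + δ) ^ k * δ + ((‖b‖ + δ) ^ k - ‖b‖ ^ k) * ‖b‖ := by gcongr
      _ = _ := by ring

lemma exists_add_pow_le {R : ℝ} (hR : 0 ≤ R) (m : ℕ) :
    ∃ C, 0 ≤ C ∧ ∀ s, 0 ≤ s → (s + R) ^ m - s ^ m ≤ s ^ m / 2 + C := by
  have h1 : Tendsto (fun u : ℝ => (1 + u) ^ m) (nhds 0) (nhds 1) := by
    have : Continuous fun u : ℝ => (1 + u) ^ m := by fun_prop
    simpa using this.tendsto 0
  have h2 : ∀ᶠ u in nhdsWithin (0 : ℝ) (Set.Ioi 0), (1 + u) ^ m ≤ 3 / 2 :=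
    (h1.mono_left nhdsWithin_le_nhds).eventually (ge_mem_nhds (by norm_num))
  obtain ⟨u, hu, hu0⟩ := (h2.and self_mem_nhdsWithin).exists
  have hu0 : 0 < u := hu0
  refine ⟨(R / u + R) ^ m, by positivity, fun s hs => ?_⟩
  have hsm : 0 ≤ s ^ m := by positivity
  rcases le_total (R / u) s with h | h
  · have h3 : s + R ≤ s * (1 + u) := by
      rw [div_le_iff₀ hu0] at h; linarith
    have h4 : (s + R) ^ m ≤ s ^ m * (3 / 2) := by
      calc (s + R) ^ m ≤ (s * (1 + u)) ^ m := by gcongr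
        _ = s ^ m * (1 + u) ^ m := mul_pow _ _ _
        _ ≤ _ := by gcongr
    have : 0 ≤ (R / u + R) ^ m := by positivity
    linarith
  · have : (s + R) ^ m ≤ (R / u + R) ^ m := by gcongr
    linarith

/-- Two-sided control of `expSum` on the region swept out by complexified lines. -/
lemma exists_expSum_bounds (hβ : ∀ n, 0 < β n) (hs : Summable fun n : ℕ => ((n : ℝ) + 1) * β n)
    (hk : 1 ≤ k) (hw0 : ∀ n, 0 ≤ w n) (hw : ∀ n : ℕ, w n ≤ n + 1) {R : ℝ} (hR : 0 ≤ R) :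
    ∃ K, 0 ≤ K ∧ ∀ s : ℝ, 0 ≤ s → ∀ X : ℂ, ‖X - (s : ℂ) ^ 2‖ ≤ (s + R) ^ 2 - s ^ 2 →
      ‖expSum w β k X‖ ≤ K * countSum w β k s + K ∧
      countSum w β k s / 4 - K ≤ (expSum w β k X).re := by
  obtain ⟨C, hC, hCs⟩ := exists_add_pow_le hR (2 * k)
  set b := ∑' n : ℕ, ((n : ℝ) + 1) * β n with hb
  have hb0 : 0 ≤ b := tsum_nonneg fun n => by have := (hβ n).le; positivity
  set K := 4 * Real.exp (b * C) + 2 * Real.exp (b * C) * (C * b) with hK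
  have hKb : C * b * Real.exp (b * C) ≤ K := by
    have : 0 ≤ C * b * Real.exp (b * C) := by positivity
    have := Real.exp_pos (b * C)
    linarith
  refine ⟨K, by positivity, fun s hs0 X hX => ?_⟩
  have hP0 : 0 ≤ s ^ (2 * k) := by positivity
  have hnorm : ‖X ^ k - ((s ^ (2 * k) : ℝ) : ℂ)‖ ≤ s ^ (2 * k) / 2 + C := by
    refine le_trans ?_ (hCs s hs0)
    have h1 := norm_pow_sub_pow_le hX k
    rw [norm_pow, Complex.norm_real, Real.norm_of_nonneg hs0, ← pow_mul, ← pow_mul] at h1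
    push_cast
    refine h1.trans (le_of_eq ?_)
    rw [show s ^ 2 + ((s + R) ^ 2 - s ^ 2) = (s + R) ^ 2 by ring, ← pow_mul]
  have hre : s ^ (2 * k) / 2 - C ≤ (X ^ k).re := by
    have h1 := neg_le_of_abs_le ((Complex.abs_re_le_norm _).trans hnorm)
    rw [Complex.sub_re, Complex.ofReal_re] at h1
    linarith
  have habs : ‖X ^ k‖ ≤ 2 * s ^ (2 * k) + C := by
    have h1 := norm_add_le (X ^ k - ((s ^ (2 * k) : ℝ) : ℂ)) ((s ^ (2 * k) : ℝ) : ℂ)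
    rw [sub_add_cancel, Complex.norm_real, Real.norm_of_nonneg hP0] at h1
    linarith
  have hsum := summable_expSum hβ hs hk hw0 hw X
  have hcs := summable_countSum (k := k) hβ hs hw0 hw s
  have hterm := norm_expSum_term_le hβ hs hw0 hw (k := k) hC (by linarith) habs
  constructor
  · have h1 : HasSum (fun n : ℕ => 2 * Real.exp (b * C) *
        (2 * (w n * min 1 (β n * s ^ (2 * k))) + C * (((n : ℝ) + 1) * β n)))
        (2 * Real.exp (b * C) * (2 * countSum w β k s + C * b)) :=
      ((hcs.hasSum.mul_left 2).add (hs.hasSum.mul_left C)).mul_left _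
    refine (tsum_of_norm_bounded h1 hterm).trans ?_
    have h2 := countSum_nonneg (k := k) hβ hw0 s
    have h3 : 0 ≤ 2 * Real.exp (b * C) * (C * b) * countSum w β k s := by positivity
    have := Real.exp_pos (b * C)
    rw [hK]
    nlinarith
  · have h1 : (expSum w β k X).re = ∑' n, ((w n : ℂ) * (1 - Complex.exp (-(β n * X ^ k)))).re :=
      Complex.re_tsum hsum
    have h2 : Summable fun n => ((w n : ℂ) * (1 - Complex.exp (-(β n * X ^ k)))).re :=
      (Complex.hasSum_re hsum.hasSum).summable
    have h3 : HasSum (fun n : ℕ => w n * min 1 (β n * s ^ (2 * k)) / 4 -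
        C * Real.exp (b * C) * (((n : ℝ) + 1) * β n))
        (countSum w β k s / 4 - C * Real.exp (b * C) * b) :=
      (hcs.hasSum.div_const 4).sub (hs.hasSum.mul_left _)
    have h4 : countSum w β k s / 4 - C * Real.exp (b * C) * b ≤ (expSum w β k X).re := by
      rw [h1, ← h3.tsum_eq]
      refine h3.summable.tsum_le_tsum (fun n => ?_) h2
      have hbn := hβ n
      have hbb := beta_le hβ hs n
      rw [Complex.re_ofReal_mul]
      have h5 := le_re_one_sub_exp_neg (Y := β n * X ^ k) (y := β n * s ^ (2 * k))
        (c := β n * C) (c' := b * C) (by positivity) (by positivity) (by gcongr)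
        (by rw [Complex.re_ofReal_mul]; nlinarith)
      have h6 := mul_le_mul_of_nonneg_left h5 (hw0 n)
      have h7 : w n * (β n * C * Real.exp (b * C)) ≤ (n + 1) * (β n * C * Real.exp (b * C)) := by
        have := hw n
        gcongr
      nlinarith
    linarith

lemma contDiff_expSum_norm_sq {d : ℕ} (hβ : ∀ n, 0 < β n)
    (hs : Summable fun n : ℕ => ((n : ℝ) + 1) * β n)
    (hk : 1 ≤ k) (hw0 : ∀ n, 0 ≤ w n) (hw : ∀ n : ℕ, w n ≤ n + 1) :
    ContDiff ℝ ∞ fun ξ : Rd d => expSum w β k (((‖ξ‖ ^ 2 : ℝ) : ℂ)) := by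
  have h1 : ContDiff ℂ ∞ (expSum w β k) := (differentiable_expSum hβ hs hk hw0 hw).contDiff
  have h2 : ContDiff ℝ ∞ fun ξ : Rd d => ((‖ξ‖ ^ 2 : ℝ) : ℂ) :=
    Complex.ofRealCLM.contDiff.comp (contDiff_norm_sq ℝ)
  exact (h1.restrict_scalars ℝ).comp h2

end expSum

/-- The complexified square norm along the line `ξ + z v`. -/
def lineNormSq {d : ℕ} (ξ v : Rd d) (z : ℂ) : ℂ :=
  ((‖ξ‖ ^ 2 : ℝ) : ℂ) + 2 * z * (⟪ξ, v⟫ : ℝ) + z ^ 2 * ((‖v‖ ^ 2 : ℝ) : ℂ)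

lemma lineNormSq_ofReal {d : ℕ} (ξ v : Rd d) (τ : ℝ) :
    lineNormSq ξ v τ = ((‖ξ + τ • v‖ ^ 2 : ℝ) : ℂ) := by
  rw [norm_add_sq_real, inner_smul_right, norm_smul, lineNormSq, mul_pow, Real.norm_eq_abs, sq_abs]
  push_cast; ring

lemma differentiable_lineNormSq {d : ℕ} (ξ v : Rd d) : Differentiable ℂ (lineNormSq ξ v) := by
  unfold lineNormSq; fun_prop

lemma norm_lineNormSq_sub_le {d : ℕ} (ξ : Rd d) {v : Rd d} (hv : ‖v‖ ≤ 1) {R : ℝ} {z : ℂ}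
    (hz : ‖z‖ ≤ R) :
    ‖lineNormSq ξ v z - (‖ξ‖ : ℂ) ^ 2‖ ≤ (‖ξ‖ + R) ^ 2 - ‖ξ‖ ^ 2 := by
  have hR : 0 ≤ R := (norm_nonneg _).trans hz
  have h1 : lineNormSq ξ v z - (‖ξ‖ : ℂ) ^ 2 =
      2 * z * (⟪ξ, v⟫ : ℝ) + z ^ 2 * ((‖v‖ ^ 2 : ℝ) : ℂ) := by
    rw [lineNormSq]; push_cast; ring
  rw [h1]
  refine (norm_add_le _ _).trans ?_
  simp only [norm_mul, norm_pow, Complex.norm_real, Complex.norm_ofNat, norm_norm]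
  have h2 : ‖⟪ξ, v⟫‖ ≤ ‖ξ‖ := by
    refine (norm_inner_le_norm ξ v).trans ?_
    exact mul_le_of_le_one_right (norm_nonneg _) hv
  have h3 : ‖v‖ ^ 2 ≤ 1 := pow_le_one₀ (norm_nonneg _) hv
  calc 2 * ‖z‖ * ‖⟪ξ, v⟫‖ + ‖z‖ ^ 2 * ‖v‖ ^ 2 ≤ 2 * R * ‖ξ‖ + R ^ 2 * 1 := by gcongr
    _ = _ := by ring

namespace IsWeightSeq

variable {A : ℕ → ℝ}

lemma bddAbove_log (hA : IsWeightSeq A) {t : ℝ} (ht : 0 ≤ t) :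
    BddAbove (Set.range fun p : ℕ => Real.log (t ^ p / A p)) := by
  have h1 := hA.2.2.2.1.eventually_ge_atTop t
  obtain ⟨p₀, hp₀⟩ := eventually_atTop.1 (h1.and (eventually_ge_atTop 1))
  refine ⟨∑ p ∈ Finset.range p₀, |Real.log (t ^ p / A p)|, ?_⟩
  rintro _ ⟨p, rfl⟩
  rcases lt_or_ge p p₀ with hp | hp
  · exact (le_abs_self _).trans (Finset.single_le_sum
      (f := fun p => |Real.log (t ^ p / A p)|) (fun _ _ => abs_nonneg _) (Finset.mem_range.2 hp))
  · refine le_trans ?_ (Finset.sum_nonneg fun _ _ => abs_nonneg _)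
    have hAp := hA.pos p
    obtain ⟨h2, h3⟩ := hp₀ p hp
    refine Real.log_nonpos (by positivity) ((div_le_one hAp).2 ?_)
    calc t ^ p ≤ (A p ^ (p : ℝ)⁻¹) ^ p := by gcongr
      _ = A p := Real.rpow_inv_natCast_pow hAp.le (by omega)

lemma pow_le_mul_exp_nuA (hA : IsWeightSeq A) {t : ℝ} (ht : 0 ≤ t) (p : ℕ) :
    t ^ p ≤ A p * Real.exp (nuA A t) := by
  have hAp := hA.pos p
  rcases (pow_nonneg ht p).eq_or_lt with h | h
  · rw [← h]; positivity
  · rw [← div_le_iff₀' hAp, ← Real.log_le_iff_le_exp (by positivity)]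
    exact le_ciSup (hA.bddAbove_log ht) p

lemma mul_exp_nuA_le (hA : IsWeightSeq A) {t y c : ℝ} (ht : 0 ≤ t) (hy : 0 ≤ y)
    (h : ∀ p, t ^ p * y ≤ c * A p) : y * Real.exp (nuA A t) ≤ c := by
  have h0 := h 0
  rw [pow_zero, one_mul, hA.2.1, mul_one] at h0
  rcases hy.eq_or_lt with rfl | hy
  · simpa using h0
  · have hc : 0 < c := hy.trans_le h0
    rw [← le_div_iff₀' hy, ← Real.le_log_iff_exp_le (by positivity)]
    refine ciSup_le fun p => ?_
    have hAp := hA.pos p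
    rcases (pow_nonneg ht p).eq_or_lt with h1 | h1
    · rw [← h1, zero_div, Real.log_zero]
      exact Real.log_nonneg ((one_le_div hy).2 h0)
    · refine Real.log_le_log (by positivity) ?_
      rw [div_le_div_iff₀ hAp hy]
      exact h p

lemma one_le_exp_nuA (hA : IsWeightSeq A) {t : ℝ} (ht : 0 ≤ t) : 1 ≤ Real.exp (nuA A t) := by
  simpa [hA.2.1] using hA.pow_le_mul_exp_nuA ht 0

lemma exp_nuA_mono (hA : IsWeightSeq A) {s t : ℝ} (hs : 0 ≤ s) (hst : s ≤ t) :
    Real.exp (nuA A s) ≤ Real.exp (nuA A t) := by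
  have := hA.mul_exp_nuA_le hs zero_le_one (c := Real.exp (nuA A t)) fun p => by
    rw [mul_one, mul_comm _ (A p)]
    exact (pow_le_pow_left₀ hs hst p).trans (hA.pow_le_mul_exp_nuA (hs.trans hst) p)
  linarith

end IsWeightSeq

lemma pD_single {d : ℕ} (i : Fin d) (a : ℕ) (f : Rd d → ℂ) :
    pD (Pi.single i a) f = (dirD (EuclideanSpace.single i (1 : ℝ)))^[a] f := by
  have key : ∀ l : List (Fin d), l.Nodup →
      l.foldr (fun j g => (dop j)^[(Pi.single i a : Fin d → ℕ) j] g) f =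
        if i ∈ l then (dirD (EuclideanSpace.single i (1 : ℝ)))^[a] f else f := by
    intro l hl
    induction l with
    | nil => simp
    | cons j l ih =>
      rw [List.nodup_cons] at hl
      rw [List.foldr_cons, ih hl.2]
      by_cases hij : i = j
      · subst hij
        simp only [hl.1, Pi.single_eq_same, List.mem_cons, true_or, if_true, if_false]
        rfl
      · rw [Pi.single_eq_of_ne (Ne.symm hij)]
        simp [hij]
  rw [pD, key _ (List.nodup_finRange d), if_pos (List.mem_finRange i)]

lemma msize_single {d : ℕ} (i : Fin d) (a : ℕ) : msize (Pi.single i a) = a := by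
  simp [msize]

lemma pD_zero {d : ℕ} (f : Rd d → ℂ) : pD 0 f = f := by
  have key : ∀ l : List (Fin d), l.foldr (fun j g => (dop j)^[(0 : Fin d → ℕ) j] g) f = f := by
    intro l
    induction l with
    | nil => rfl
    | cons j l ih => simp
  exact key _

lemma contDiff_pD {d : ℕ} {f : Rd d → ℂ} (hf : ContDiff ℝ ∞ f) (α : Fin d → ℕ) :
    ContDiff ℝ ∞ (pD α f) := by
  have key : ∀ l : List (Fin d), ContDiff ℝ ∞ (l.foldr (fun j g => (dop j)^[α j] g) f) := by
    intro l
    induction l with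
    | nil => exact hf
    | cons j l ih => exact contDiff_dirD_iterate ih _ _
  exact key _

lemma GSBeuBdd.exists_bound {d : ℕ} {M A : ℕ → ℝ} (hM : IsWeightSeq M) (hA : IsWeightSeq A)
    {B : Set (Rd d → ℂ)} (hB : GSBeuBdd d M A B) {h : ℝ} (hh : 0 < h) :
    ∃ C, 0 ≤ C ∧ ∀ φ ∈ B, ∀ (α : Fin d → ℕ) (p : ℕ) (x : Rd d),
      (h * ‖x‖) ^ p * ‖pD α φ x‖ ≤ C * (M (msize α) / h ^ msize α) * A p := by
  obtain ⟨C, hC⟩ := hB.2 h hh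
  refine ⟨max C 0, le_max_right _ _, fun φ hφ α p x => ?_⟩
  have h1 := hC φ hφ α x
  have h2 := hA.pow_le_mul_exp_nuA (t := h * ‖x‖) (by positivity) p
  have hMα := hM.pos (msize α)
  have hAp := hA.pos p
  have hha : 0 < h ^ msize α := by positivity
  calc (h * ‖x‖) ^ p * ‖pD α φ x‖ ≤ A p * Real.exp (nuA A (h * ‖x‖)) * ‖pD α φ x‖ := by gcongr
    _ = (h ^ msize α * ‖pD α φ x‖ * Real.exp (nuA A (h * ‖x‖))) * A p / h ^ msize α := by
      field_simp
    _ ≤ (C * M (msize α)) * A p / h ^ msize α := by gcongr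
    _ ≤ (max C 0 * M (msize α)) * A p / h ^ msize α := by
      gcongr
      exact le_max_left _ _
    _ = _ := by ring

lemma GSBeuBdd.rapidDecay_pD {d : ℕ} {M A : ℕ → ℝ} (hM : IsWeightSeq M) (hA : IsWeightSeq A)
    {B : Set (Rd d → ℂ)} (hB : GSBeuBdd d M A B) {φ : Rd d → ℂ} (hφ : φ ∈ B) (α : Fin d → ℕ) :
    RapidDecay (pD α φ) := by
  refine ⟨(contDiff_pD (hB.1 φ hφ).1 α).continuous, fun n => ?_⟩
  obtain ⟨C, -, hC⟩ := hB.exists_bound hM hA one_pos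
  exact ⟨_, fun x => by simpa using hC φ hφ α n x⟩

/-- Directional derivatives of the Fourier transform of a function with `A`-decay. -/
lemma exists_norm_dirD_fourier_le (d : ℕ) {A : ℕ → ℝ} (hA : IsWeightSeq A) (hA2 : M2 A) {R : ℝ}
    (hR : 0 < R) : ∃ h₀ : ℝ, 0 < h₀ ∧ ∀ h, h₀ ≤ h → ∃ K, 0 ≤ K ∧ ∀ f : Rd d → ℂ, RapidDecay f →
      ∀ c, 0 ≤ c → (∀ p x, (h * ‖x‖) ^ p * ‖f x‖ ≤ c * A p) →
      ∀ v : Rd d, ‖v‖ ≤ 1 → ∀ q ξ, ‖(dirD v)^[q] (𝓕 f) ξ‖ ≤ K * c * A q / R ^ q := by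
  obtain ⟨C₀, H, hC₀, hH, hM2⟩ := hA2
  refine ⟨2 * Real.pi * H * R, by positivity, fun h hh => ?_⟩
  have hh0 : 0 < h := lt_of_lt_of_le (by positivity) hh
  have hAd := hA.pos (d + 1)
  set T : ℝ := C₀ * H ^ (d + 1) * A (d + 1) / h ^ (d + 1) with hT
  have hI : 0 ≤ ∫ x : Rd d, decayWeight d x := integral_nonneg fun x => (decayWeight_pos x).le
  refine ⟨2 ^ d * (1 + T) * ∫ x : Rd d, decayWeight d x, by positivity,
    fun f hf c hc hfc v hv q ξ => ?_⟩
  have hAq := hA.pos q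
  have hH0 : 0 < H := by linarith
  obtain ⟨h1, h2⟩ := hf.dirD_iterate_fourier v q
  rw [h2]
  refine (norm_fourier_le_integral _ ξ).trans ?_
  have hpt : ∀ x, ‖(-(2 * Real.pi * Complex.I) * ((⟪x, v⟫ : ℝ) : ℂ)) ^ q * f x‖ ≤
      2 ^ d * (1 + T) * (c * A q / R ^ q) * decayWeight d x := by
    intro x
    have hy : ‖(-(2 * Real.pi * Complex.I) * ((⟪x, v⟫ : ℝ) : ℂ)) ^ q * f x‖ ≤
        (2 * Real.pi * ‖x‖) ^ q * ‖f x‖ := by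
      rw [norm_mul, norm_pow]
      gcongr
      rw [norm_mul, norm_neg, Complex.norm_real]
      have : ‖⟪x, v⟫‖ ≤ ‖x‖ :=
        (norm_inner_le_norm x v).trans (mul_le_of_le_one_right (norm_nonneg _) hv)
      have h3 : ‖(2 * Real.pi * Complex.I : ℂ)‖ = 2 * Real.pi := by
        simp [abs_of_pos Real.pi_pos]
      rw [h3]
      gcongr
    refine hy.trans ?_
    have hr : (2 * Real.pi / h) ^ q ≤ 1 / (H ^ q * R ^ q) := by
      rw [← mul_pow, ← one_div_pow]
      gcongr ?_ ^ q
      rw [div_le_div_iff₀ hh0 (by positivity)]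
      linarith
    have hq1 : (2 * Real.pi * ‖x‖) ^ q * ‖f x‖ ≤ c * A q / R ^ q := by
      calc (2 * Real.pi * ‖x‖) ^ q * ‖f x‖
          = (2 * Real.pi / h) ^ q * ((h * ‖x‖) ^ q * ‖f x‖) := by
            rw [← mul_assoc, ← mul_pow]; congr 2; field_simp
        _ ≤ (1 / (H ^ q * R ^ q)) * (c * A q) := by
            exact mul_le_mul hr (hfc q x) (by positivity) (by positivity)
        _ ≤ (1 / (1 * R ^ q)) * (c * A q) := by
            gcongr
            exact one_le_pow₀ hH
        _ = _ := by ring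
    have hq2 : ‖x‖ ^ (d + 1) * ((2 * Real.pi * ‖x‖) ^ q * ‖f x‖) ≤ T * (c * A q / R ^ q) := by
      calc ‖x‖ ^ (d + 1) * ((2 * Real.pi * ‖x‖) ^ q * ‖f x‖)
          = (2 * Real.pi / h) ^ q / h ^ (d + 1) * ((h * ‖x‖) ^ (q + (d + 1)) * ‖f x‖) := by
            simp only [div_pow, pow_add, mul_pow]; field_simp
        _ ≤ (1 / (H ^ q * R ^ q)) / h ^ (d + 1) * (c * A (q + (d + 1))) := by
            exact mul_le_mul (by gcongr) (hfc _ x) (by positivity) (by positivity)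
        _ ≤ (1 / (H ^ q * R ^ q)) / h ^ (d + 1) *
            (c * (C₀ * H ^ (q + (d + 1)) * A q * A (d + 1))) := by
            gcongr
            exact hM2 q (d + 1)
        _ = _ := by rw [hT, pow_add, pow_add]; field_simp
    have := norm_le_decayWeight hq1 hq2 (by positivity)
    refine this.trans (le_of_eq (by ring))
  calc ∫ x, ‖(-(2 * Real.pi * Complex.I) * ((⟪x, v⟫ : ℝ) : ℂ)) ^ q * f x‖
      ≤ ∫ x, 2 ^ d * (1 + T) * (c * A q / R ^ q) * decayWeight d x :=
        integral_mono h1.integrable.norm ((integrable_decayWeight d).const_mul _) hpt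
    _ = _ := by rw [integral_const_mul]; ring

/-- Joint decay and regularity of the Fourier transforms of a bounded set. -/
lemma GSBeuBdd.exists_fourier_bound {d : ℕ} {M A : ℕ → ℝ} (hM : IsWeightSeq M)
    (hA : IsWeightSeq A) (hA2 : M2 A) {B : Set (Rd d → ℂ)} (hB : GSBeuBdd d M A B) {R κ : ℝ}
    (hR : 0 < R) (hκ : 0 < κ) : ∃ D, 0 ≤ D ∧ ∀ φ ∈ B, ∀ v : Rd d, ‖v‖ ≤ 1 → ∀ q ξ,
      ‖(dirD v)^[q] (𝓕 φ) ξ‖ ≤ D * A q / R ^ q ∧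
      ∀ i a, ‖(dirD v)^[q] (fun ξ => (ξ i : ℂ) ^ a * 𝓕 φ ξ) ξ‖ ≤
        D * (M a / κ ^ a) * A q / R ^ q := by
  obtain ⟨h₀, hh₀, hfour⟩ := exists_norm_dirD_fourier_le d hA hA2 hR
  have hh : 0 < max h₀ κ := lt_max_of_lt_left hh₀
  obtain ⟨K, hK, hfour⟩ := hfour _ (le_max_left h₀ κ)
  obtain ⟨C, hC, hbd⟩ := hB.exists_bound hM hA hh
  refine ⟨K * C, by positivity, fun φ hφ v hv q ξ => ⟨?_, fun i a => ?_⟩⟩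
  · have h1 := hB.rapidDecay_pD hM hA hφ 0
    have h2 := hbd φ hφ 0
    simp only [pD_zero] at h1 h2
    exact hfour φ h1 C hC (fun p x => by simpa [msize, hM.2.1] using h2 p x) v hv q ξ
  · set e : Rd d := EuclideanSpace.single i (1 : ℝ) with he
    have hrd : ∀ b, RapidDecay ((dirD e)^[b] φ) := fun b => by
      rw [he, ← pD_single]; exact hB.rapidDecay_pD hM hA hφ _
    set c : ℂ := (2 * Real.pi * Complex.I) ^ a with hc
    have hc0 : c ≠ 0 := pow_ne_zero _ (by simp [Real.pi_ne_zero])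
    have hcn : 1 ≤ ‖c‖ := by
      rw [hc, norm_pow]
      refine one_le_pow₀ ?_
      simp only [Complex.norm_mul, Complex.norm_ofNat, Complex.norm_real, Complex.norm_I, mul_one,
        Real.norm_of_nonneg Real.pi_pos.le]
      linarith [Real.pi_gt_three]
    have hg : RapidDecay fun x => c⁻¹ * (dirD e)^[a] φ x := by
      have := (hrd a).mul_bounded (g := fun _ => c⁻¹) continuous_const (C := ‖c⁻¹‖) (fun _ => le_rfl)
      simpa [mul_comm] using this
    have heq : (fun ξ : Rd d => (ξ i : ℂ) ^ a * 𝓕 φ ξ) = 𝓕 (fun x => c⁻¹ * (dirD e)^[a] φ x) := by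
      ext η
      have h1 := fourier_dirD_iterate (hB.1 φ hφ).1 (v := e) (fun b => (hrd b).integrable) a η
      have h2 : 𝓕 (fun x => c⁻¹ * (dirD e)^[a] φ x) η = c⁻¹ * 𝓕 ((dirD e)^[a] φ) η := by
        rw [Real.fourier_eq, Real.fourier_eq, ← integral_const_mul]
        congr 1; ext x
        rw [mul_smul_comm]
      rw [h2, h1, mul_pow, ← hc, he, EuclideanSpace.inner_single_right]
      simp only [one_mul, conj_trivial]
      field_simp
    rw [heq]
    have hMa := hM.pos a
    have := hfour _ hg (C * (M a / κ ^ a)) (by positivity) (fun p x => ?_) v hv q ξ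
    · refine this.trans (le_of_eq (by ring))
    · have h3 := hbd φ hφ (Pi.single i a) p x
      rw [msize_single, pD_single] at h3
      rw [norm_mul, norm_inv]
      calc (max h₀ κ * ‖x‖) ^ p * (‖c‖⁻¹ * ‖(dirD e)^[a] φ x‖)
          ≤ (max h₀ κ * ‖x‖) ^ p * (1 * ‖(dirD e)^[a] φ x‖) := by
            gcongr
            exact inv_le_one_of_one_le₀ hcn
        _ ≤ C * (M a / max h₀ κ ^ a) * A p := by rw [one_mul]; exact h3
        _ ≤ _ := by
            have := (hA.pos p).le
            gcongr
            exact le_max_right _ _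

/-- Directional derivatives of the functions in `S` satisfy `A`-bounds with decay faster than any
`exp (-m W)`, uniformly after multiplication by functions holomorphic along the line. -/
def LineBounded {d : ℕ} (W : ℝ → ℝ) (A : ℕ → ℝ) (l : ℝ) (S : Set (Rd d → ℂ)) : Prop :=
  ∀ (R : ℕ) (m : ℝ), 0 ≤ m → ∃ C, 0 ≤ C ∧ ∀ Φ ∈ S, ∀ ξ v : Rd d, ‖v‖ ≤ 1 →
    ∀ (G : Rd d → ℂ) (P : ℂ → ℂ) (b : ℝ), ContDiff ℝ ∞ G → Differentiable ℂ P →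
    (∀ z : ℂ, ‖z‖ ≤ R + 1 → ‖P z‖ ≤ b) → (∀ τ : ℝ, G (ξ + τ • v) = P τ) →
    ∀ p, ‖(dirD v)^[p] (fun η => G η * Φ η) ξ‖ ≤
      C * b * Real.exp (-(m * W ‖ξ‖)) * (l / (R + 1)) ^ p * A p

/-- Powers are dominated by `M` up to an exponential of `W`. -/
def PowDominated (W : ℝ → ℝ) (M : ℕ → ℝ) : Prop :=
  ∀ κ : ℝ, 0 ≤ κ → ∀ R : ℝ, 0 ≤ R → ∃ C, 0 ≤ C ∧ ∀ t, 0 ≤ t → ∀ a : ℕ,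
    (κ * (t + R)) ^ a ≤ M a * Real.exp (C * W t + C)

lemma contDiff_monom {d : ℕ} (c : ℂ) (α : Fin d → ℕ) : ContDiff ℝ ∞ (monom c α) := by
  unfold monom
  refine contDiff_prod fun j _ => (contDiff_const.mul ?_).pow _
  exact Complex.ofRealCLM.contDiff.comp (EuclideanSpace.proj (𝕜 := ℝ) j).contDiff

lemma norm_coord_line_le {d : ℕ} (ξ : Rd d) {v : Rd d} (hv : ‖v‖ ≤ 1) (j : Fin d) {z : ℂ} {r : ℝ}
    (hz : ‖z‖ ≤ r) : ‖(ξ j : ℂ) + z * (v j : ℂ)‖ ≤ ‖ξ‖ + r := by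
  refine (norm_add_le _ _).trans ?_
  rw [norm_mul, Complex.norm_real, Complex.norm_real]
  have h1 : ‖ξ j‖ ≤ ‖ξ‖ := PiLp.norm_apply_le ξ j
  have h2 : ‖v j‖ ≤ 1 := (PiLp.norm_apply_le v j).trans hv
  have h3 : ‖z‖ * ‖v j‖ ≤ r * 1 := mul_le_mul hz h2 (norm_nonneg _) ((norm_nonneg _).trans hz)
  linarith

namespace LineBounded

variable {d : ℕ} {W : ℝ → ℝ} {M A : ℕ → ℝ} {l : ℝ} {S : Set (Rd d → ℂ)}

lemma rapidDecay (hS : LineBounded W A l S) (hMpos : ∀ p, 0 < M p) (hA : ∀ p, 0 < A p)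
    (hW : PowDominated W M) {Φ : Rd d → ℂ} (hΦ : Φ ∈ S) (hc : Continuous Φ) : RapidDecay Φ := by
  refine ⟨hc, fun n => ?_⟩
  obtain ⟨C₁, hC₁, h1⟩ := hW 1 zero_le_one 0 le_rfl
  obtain ⟨C, hC, h2⟩ := hS 0 C₁ hC₁
  refine ⟨M n * Real.exp C₁ * C * A 0, fun x => ?_⟩
  have h3 := h1 ‖x‖ (norm_nonneg _) n
  have h4 := h2 Φ hΦ x 0 (by simp) (fun _ => 1) (fun _ => 1) 1 contDiff_const
    (differentiable_const _) (by simp) (by simp) 0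
  simp only [one_mul, add_zero, Function.iterate_zero, id, mul_one, pow_zero] at h3 h4
  have hMn := hMpos n
  have hA0 := hA 0
  calc ‖x‖ ^ n * ‖Φ x‖ ≤ (M n * Real.exp (C₁ * W ‖x‖ + C₁)) *
        (C * Real.exp (-(C₁ * W ‖x‖)) * A 0) := by gcongr
    _ = M n * (Real.exp (C₁ * W ‖x‖ + C₁) * Real.exp (-(C₁ * W ‖x‖))) * C * A 0 := by ring
    _ = _ := by rw [← Real.exp_add]; congr 4; ring

lemma monom_bound (hS : LineBounded W A l S) (hMpos : ∀ p, 0 < M p) (hA : ∀ p, 0 < A p)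
    (hl : 0 ≤ l) (hW : PowDominated W M) (c : ℂ) (R : ℕ) {h : ℝ} (hh : 0 < h) :
    ∃ C, 0 ≤ C ∧ ∀ Φ ∈ S, ∀ α : Fin d → ℕ, ∀ v : Rd d, ‖v‖ ≤ 1 → ∀ p ξ,
      ‖(dirD v)^[p] (fun η => monom c α η * Φ η) ξ‖ ≤
        C * (M (msize α) / h ^ msize α) * (l / (R + 1)) ^ p * A p * decayWeight d ξ := by
  obtain ⟨C₁, hC₁, h1⟩ := hW (‖c‖ * h) (by positivity) (R + 1) (by positivity)
  obtain ⟨C₂, hC₂, h2⟩ := hW 1 zero_le_one 1 zero_le_one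
  obtain ⟨C, hC, h3⟩ := hS R (C₁ + C₂) (by positivity)
  have hMd := hMpos (d + 1)
  refine ⟨C * Real.exp C₁ * (M (d + 1) * Real.exp C₂), by positivity,
    fun Φ hΦ α v hv p ξ => ?_⟩
  have hMα := hMpos (msize α)
  have hAp := hA p
  have h4 := h3 Φ hΦ ξ v hv (monom c α) (fun z => ∏ j, (c * ((ξ j : ℂ) + z * (v j : ℂ))) ^ α j)
    (M (msize α) / h ^ msize α * Real.exp (C₁ * W ‖ξ‖ + C₁)) (contDiff_monom c α)
    (by fun_prop) (fun z hz => ?_) (fun τ => ?_) p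
  · refine h4.trans ?_
    have h5 : 1 ≤ M (d + 1) * Real.exp (C₂ * W ‖ξ‖ + C₂) * decayWeight d ξ := by
      have := h2 ‖ξ‖ (norm_nonneg _) (d + 1)
      rw [one_mul, add_comm ‖ξ‖ 1] at this
      rw [decayWeight, ← div_eq_mul_inv, le_div_iff₀ (by positivity), one_mul]
      exact this
    calc C * (M (msize α) / h ^ msize α * Real.exp (C₁ * W ‖ξ‖ + C₁)) *
          Real.exp (-((C₁ + C₂) * W ‖ξ‖)) * (l / (R + 1)) ^ p * A p
        ≤ C * (M (msize α) / h ^ msize α * Real.exp (C₁ * W ‖ξ‖ + C₁)) *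
          Real.exp (-((C₁ + C₂) * W ‖ξ‖)) * (l / (R + 1)) ^ p * A p *
          (M (d + 1) * Real.exp (C₂ * W ‖ξ‖ + C₂) * decayWeight d ξ) :=
          le_mul_of_one_le_right (by positivity) h5
      _ = C * (M (msize α) / h ^ msize α) * (Real.exp (C₁ * W ‖ξ‖ + C₁) *
          Real.exp (-((C₁ + C₂) * W ‖ξ‖)) * Real.exp (C₂ * W ‖ξ‖ + C₂)) * (l / (R + 1)) ^ p * A p *
          M (d + 1) * decayWeight d ξ := by ring
      _ = C * (M (msize α) / h ^ msize α) * (Real.exp C₁ * Real.exp C₂) * (l / (R + 1)) ^ p * A p *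
          M (d + 1) * decayWeight d ξ := by
          rw [← Real.exp_add, ← Real.exp_add, ← Real.exp_add]; congr 6; ring
      _ = _ := by ring
  · rw [norm_prod]
    have h6 := h1 ‖ξ‖ (norm_nonneg _) (msize α)
    calc ∏ j, ‖(c * ((ξ j : ℂ) + z * (v j : ℂ))) ^ α j‖
        ≤ ∏ j, (‖c‖ * (‖ξ‖ + (R + 1))) ^ α j := by
          refine Finset.prod_le_prod (fun _ _ => norm_nonneg _) fun j _ => ?_
          rw [norm_pow, norm_mul]
          gcongr
          exact norm_coord_line_le ξ hv j hz
      _ = (‖c‖ * h * (‖ξ‖ + (R + 1))) ^ msize α / h ^ msize α := by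
          rw [Finset.prod_pow_eq_pow_sum, ← msize, ← div_pow]
          congr 1; field_simp
      _ ≤ (M (msize α) * Real.exp (C₁ * W ‖ξ‖ + C₁)) / h ^ msize α := by gcongr
      _ = _ := by ring
  · simp [monom]

lemma fourierInv_bound (hS : LineBounded W A l S) (hMpos : ∀ p, 0 < M p) (hA : ∀ p, 0 < A p)
    (hl : 0 ≤ l) (hW : PowDominated W M) (hsm : ∀ Φ ∈ S, ContDiff ℝ ∞ Φ) (R : ℕ)
    {h : ℝ} (hh : 0 < h) :
    ∃ C, 0 ≤ C ∧ ∀ Φ ∈ S, ∀ α : Fin d → ℕ, ∀ p x,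
      ‖x‖ ^ p * ‖pD α (𝓕⁻ Φ) x‖ ≤
        C * (M (msize α) / h ^ msize α) * (l / (R + 1)) ^ p * A p := by
  obtain ⟨C, hC, hbd⟩ := hS.monom_bound hMpos hA hl hW (2 * Real.pi * Complex.I) R hh
  have hI : 0 ≤ ∫ x : Rd d, decayWeight d x := integral_nonneg fun x => (decayWeight_pos x).le
  refine ⟨C * ∫ x : Rd d, decayWeight d x, by positivity, fun Φ hΦ α p x => ?_⟩
  have hrd := hS.rapidDecay hMpos hA hW hΦ (hsm Φ hΦ).continuous
  obtain ⟨-, h1⟩ := hrd.pD_fourierInv α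
  rw [h1]
  set Ψ : Rd d → ℂ := fun ξ => monom (2 * Real.pi * Complex.I) α ξ * Φ ξ with hΨ
  have hΨs : ContDiff ℝ ∞ Ψ := (contDiff_monom _ α).mul (hsm Φ hΦ)
  set v : Rd d := ‖x‖⁻¹ • x with hv
  have hv1 : ‖v‖ ≤ 1 := by
    rw [hv, norm_smul, norm_inv, norm_norm]
    exact inv_mul_le_one_of_le₀ le_rfl (norm_nonneg _)
  have hxv : ⟪x, v⟫ = ‖x‖ := by
    rw [hv, inner_smul_right, real_inner_self_eq_norm_sq]
    rcases eq_or_ne ‖x‖ 0 with h0 | h0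
    · simp [h0]
    · field_simp
  have hint : ∀ q, Integrable ((dirD v)^[q] Ψ) := fun q =>
    ((integrable_decayWeight d).const_mul _).mono'
      (contDiff_dirD_iterate hΨs v q).continuous.aestronglyMeasurable
      (Eventually.of_forall (hbd Φ hΦ α v hv1 q))
  have h2 := fourierInv_dirD_iterate hΨs hint p x
  have h3 := norm_fourierInv_le_integral ((dirD v)^[p] Ψ) x
  rw [h2, hxv, norm_mul, norm_pow, norm_mul, norm_neg, Complex.norm_real, norm_norm] at h3
  have h4 : (1 : ℝ) ≤ ‖(2 * Real.pi * Complex.I : ℂ)‖ := by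
    simp only [Complex.norm_mul, Complex.norm_ofNat, Complex.norm_real, Complex.norm_I, mul_one,
      Real.norm_of_nonneg Real.pi_pos.le]
    linarith [Real.pi_gt_three]
  calc ‖x‖ ^ p * ‖𝓕⁻ Ψ x‖ ≤ (‖(2 * Real.pi * Complex.I : ℂ)‖ * ‖x‖) ^ p * ‖𝓕⁻ Ψ x‖ := by
        gcongr
        exact le_mul_of_one_le_left (norm_nonneg _) h4
    _ ≤ ∫ y, ‖(dirD v)^[p] Ψ y‖ := h3
    _ ≤ ∫ y, C * (M (msize α) / h ^ msize α) * (l / (R + 1)) ^ p * A p * decayWeight d y :=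
        integral_mono (hint p).norm ((integrable_decayWeight d).const_mul _)
          (hbd Φ hΦ α v hv1 p)
    _ = _ := by rw [integral_const_mul]; ring

lemma gsBeuBdd_fourierInv (hS : LineBounded W A l S) (hM : IsWeightSeq M) (hA : IsWeightSeq A)
    (hl : 0 ≤ l) (hW : PowDominated W M) (hsm : ∀ Φ ∈ S, ContDiff ℝ ∞ Φ) :
    GSBeuBdd d M A ((fun Φ => 𝓕⁻ Φ) '' S) := by
  have key : ∀ h : ℝ, 0 < h → ∃ C : ℝ, ∀ φ ∈ (fun Φ : Rd d → ℂ => 𝓕⁻ Φ) '' S,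
      ∀ (α : Fin d → ℕ) (x : Rd d),
      h ^ msize α * ‖pD α φ x‖ * Real.exp (nuA A (h * ‖x‖)) ≤ C * M (msize α) := by
    intro h hh
    obtain ⟨R, hR⟩ := exists_nat_ge (l * h)
    obtain ⟨C, hC, hbd⟩ := hS.fourierInv_bound hM.pos hA.pos hl hW hsm R hh
    refine ⟨C, ?_⟩
    rintro _ ⟨Φ, hΦ, rfl⟩ α x
    have hMα := hM.pos (msize α)
    have h1 := hA.mul_exp_nuA_le (t := h * ‖x‖) (y := ‖pD α (𝓕⁻ Φ) x‖)
      (c := C * (M (msize α) / h ^ msize α)) (by positivity) (norm_nonneg _) (fun p => ?_)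
    · rw [mul_assoc]
      calc h ^ msize α * (‖pD α (𝓕⁻ Φ) x‖ * Real.exp (nuA A (h * ‖x‖)))
          ≤ h ^ msize α * (C * (M (msize α) / h ^ msize α)) := by gcongr
        _ = _ := by field_simp
    · have hAp := hA.pos p
      have h2 : (h * (l / (R + 1))) ^ p ≤ 1 := by
        refine pow_le_one₀ (by positivity) ?_
        rw [← mul_div_assoc, div_le_one (by positivity)]
        linarith
      calc (h * ‖x‖) ^ p * ‖pD α (𝓕⁻ Φ) x‖ = h ^ p * (‖x‖ ^ p * ‖pD α (𝓕⁻ Φ) x‖) := by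
            rw [mul_pow]; ring
        _ ≤ h ^ p * (C * (M (msize α) / h ^ msize α) * (l / (R + 1)) ^ p * A p) := by
            gcongr h ^ p * ?_
            exact hbd Φ hΦ α p x
        _ = C * (M (msize α) / h ^ msize α) * A p * (h * (l / (R + 1))) ^ p := by
            rw [mul_pow]; ring
        _ ≤ _ := mul_le_of_le_one_right (by positivity) h2
  refine ⟨?_, key⟩
  rintro _ ⟨Φ, hΦ, rfl⟩
  refine ⟨(hS.rapidDecay hM.pos hA.pos hW hΦ (hsm Φ hΦ).continuous).contDiff_fourierInv,
    fun h hh => ?_⟩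
  obtain ⟨C, hC⟩ := key h hh
  exact ⟨C, hC _ ⟨Φ, hΦ, rfl⟩⟩

lemma kBeu_fourierInv (hS : LineBounded W (fun p => (p.factorial : ℝ)) l S) (hM : IsWeightSeq M)
    (hl : 0 ≤ l) (hW : PowDominated W M) (hsm : ∀ Φ ∈ S, ContDiff ℝ ∞ Φ) {Φ : Rd d → ℂ}
    (hΦ : Φ ∈ S) : KBeu d M (𝓕⁻ Φ) := by
  have hpos : ∀ p : ℕ, (0 : ℝ) < p.factorial := fun p => by exact_mod_cast p.factorial_pos
  refine ⟨(hS.rapidDecay hM.pos hpos hW hΦ (hsm Φ hΦ).continuous).contDiff_fourierInv,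
    fun h hh n => ?_⟩
  obtain ⟨R, hR⟩ := exists_nat_ge (2 * l * n)
  obtain ⟨C, hC, hbd⟩ := hS.fourierInv_bound hM.pos hpos hl hW hsm R hh
  refine ⟨2 * C, fun α x => ?_⟩
  have hMα := hM.pos (msize α)
  set y := ‖pD α (𝓕⁻ Φ) x‖ with hy
  have h1 : HasSum (fun p : ℕ => y * ((n * ‖x‖) ^ p / p.factorial)) (y * Real.exp (n * ‖x‖)) := by
    rw [Real.exp_eq_exp_ℝ]
    exact (NormedSpace.expSeries_div_hasSum_exp (𝔸 := ℝ) (n * ‖x‖)).mul_left y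
  have h2 : HasSum (fun p : ℕ => C * (M (msize α) / h ^ msize α) * ((1 : ℝ) / 2) ^ p)
      (C * (M (msize α) / h ^ msize α) * 2) := hasSum_geometric_two.mul_left _
  have h3 : y * Real.exp (n * ‖x‖) ≤ C * (M (msize α) / h ^ msize α) * 2 := by
    refine hasSum_le (fun p => ?_) h1 h2
    have hp := hpos p
    have h4 : (n * (l / (R + 1))) ^ p ≤ ((1 : ℝ) / 2) ^ p := by
      refine pow_le_pow_left₀ (by positivity) ?_ p
      rw [← mul_div_assoc, div_le_div_iff₀ (by positivity) (by norm_num)]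
      linarith
    calc y * ((n * ‖x‖) ^ p / p.factorial) = n ^ p * (‖x‖ ^ p * y) / p.factorial := by
          rw [mul_pow]; ring
      _ ≤ n ^ p * (C * (M (msize α) / h ^ msize α) * (l / (R + 1)) ^ p * p.factorial)
            / p.factorial := by
          gcongr ?_ / _
          gcongr (n : ℝ) ^ p * ?_
          exact hbd Φ hΦ α p x
      _ = C * (M (msize α) / h ^ msize α) * (n * (l / (R + 1))) ^ p := by
          rw [mul_pow]; field_simp
      _ ≤ _ := by gcongr
  calc h ^ msize α * y * Real.exp (n * ‖x‖) = h ^ msize α * (y * Real.exp (n * ‖x‖)) := by ring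
    _ ≤ h ^ msize α * (C * (M (msize α) / h ^ msize α) * 2) := by gcongr
    _ = _ := by field_simp

end LineBounded

lemma exists_norm_div_le_abs_coord {d : ℕ} {ξ : Rd d} (hξ : 0 < ‖ξ‖) :
    ∃ i, ‖ξ‖ / (d + 1) ≤ |ξ i| := by
  by_contra! h
  have h1 : ‖ξ‖ ^ 2 ≤ ∑ _i : Fin d, (‖ξ‖ / (d + 1)) ^ 2 := by
    rw [EuclideanSpace.norm_sq_eq]
    refine Finset.sum_le_sum fun i _ => ?_
    rw [Real.norm_eq_abs, EuclideanSpace.norm_eq]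
    have := (h i).le
    rw [EuclideanSpace.norm_eq] at this
    exact pow_le_pow_left₀ (abs_nonneg _) this 2
  rw [Finset.sum_const, Finset.card_univ, Fintype.card_fin, nsmul_eq_mul, div_pow,
    mul_div_assoc', le_div_iff₀ (by positivity), mul_comm (d : ℝ)] at h1
  have h2 := le_of_mul_le_mul_left h1 (by positivity)
  nlinarith

lemma dirD_iterate_succ_const {d : ℕ} (v : Rd d) (q : ℕ) (c : ℂ) :
    (dirD v)^[q + 1] (fun _ => c) = fun _ => 0 := by
  have h : ∀ c : ℂ, dirD v (fun _ => c) = fun _ => 0 := fun c => by ext x; simp [dirD]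
  rw [Function.iterate_succ_apply, h]
  exact Function.iterate_fixed (h 0) q

section

variable {w β : ℕ → ℝ} {k : ℕ}

lemma lineBounded_exp_neg (d : ℕ) (hβ : ∀ n, 0 < β n)
    (hs : Summable fun n : ℕ => ((n : ℝ) + 1) * β n)
    (hk : 1 ≤ k) (hw0 : ∀ n, 0 ≤ w n) (hw : ∀ n : ℕ, w n ≤ n + 1)
    (hdom : ∀ m : ℝ, 0 ≤ m → ∃ C, ∀ t, m * countSum 1 β k t ≤ countSum w β k t + C) :
    LineBounded (countSum 1 β k) (fun p => (p.factorial : ℝ)) 2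
      {fun ξ : Rd d => Complex.exp (-expSum w β k (((‖ξ‖ ^ 2 : ℝ) : ℂ)))} := by
  intro R m hm
  obtain ⟨K, hK, hb⟩ := exists_expSum_bounds hβ hs hk hw0 hw (R := R + 1) (by positivity)
  obtain ⟨C, hC⟩ := hdom (4 * m) (by positivity)
  refine ⟨Real.exp (K + C / 4), (Real.exp_pos _).le, ?_⟩
  rintro _ rfl ξ v hv G P b hG hP hPb hGP p
  have hsm : ContDiff ℝ ∞ fun ξ : Rd d => Complex.exp (-expSum w β k (((‖ξ‖ ^ 2 : ℝ) : ℂ))) :=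
    (contDiff_expSum_norm_sq hβ hs hk hw0 hw).neg.cexp
  have hb0 : 0 ≤ b := (norm_nonneg _).trans (hPb 0 (by rw [norm_zero]; positivity))
  have key := norm_dirD_iterate_le (A := fun p => (p.factorial : ℝ)) (C := 1) (L := 1)
    (R := R + 1) (D := 1) (f := fun η => G η * Complex.exp (-expSum w β k (((‖η‖ ^ 2 : ℝ) : ℂ))))
    (g := fun _ => 1) (ξ := ξ) (v := v)
    (H := fun z => P z * Complex.exp (-expSum w β k (lineNormSq ξ v z)))
    (B := b * Real.exp (-(m * countSum 1 β k ‖ξ‖)) * Real.exp (K + C / 4))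
    (fun p => by exact_mod_cast p.factorial_pos)
    (fun p q => by
      exact_mod_cast Nat.le_of_dvd (Nat.factorial_pos _) (Nat.factorial_mul_factorial_dvd_factorial_add p q))
    zero_le_one le_rfl (fun p => by simp) (by positivity) zero_le_one (hG.mul hsm) contDiff_const
    (hP.mul ((differentiable_expSum hβ hs hk hw0 hw).comp
      (differentiable_lineNormSq ξ v)).neg.cexp).differentiableOn
    (fun z hz => ?_) (fun τ _ => ?_) (fun q => ?_) p
  · refine key.trans (le_of_eq ?_)
    ring
  · rw [norm_mul, mul_assoc, Complex.norm_exp, Complex.neg_re, ← Real.exp_add]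
    gcongr
    · exact hPb z hz
    · have h1 := (hb ‖ξ‖ (norm_nonneg _) _ (norm_lineNormSq_sub_le ξ hv hz)).2
      have h2 := hC ‖ξ‖
      linarith
  · simp only [hGP, lineNormSq_ofReal, mul_one]
  · cases q with
    | zero => simp
    | succ q => rw [dirD_iterate_succ_const, norm_zero]; positivity

theorem exists_lineBounded_exp_mul_fourier {d : ℕ} {M A : ℕ → ℝ} (hM : IsWeightSeq M)
    (hA : IsWeightSeq A) (hA2 : M2 A) {C L : ℝ} (hC : 0 ≤ C) (hL : 1 ≤ L)
    (hfact : ∀ p : ℕ, (p.factorial : ℝ) ≤ C * L ^ p * A p)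
    (hβ : ∀ n, 0 < β n) (hs : Summable fun n : ℕ => ((n : ℝ) + 1) * β n) (hk : 1 ≤ k)
    (hlow : ∀ K : ℝ, 0 ≤ K → ∃ κ C : ℝ, 1 ≤ κ ∧ 0 ≤ C ∧ ∀ t, 0 ≤ t → ∃ a : ℕ,
        M a * Real.exp (K * countSum 1 β k t) ≤ C * (κ * t) ^ a)
    {B : Set (Rd d → ℂ)} (hB : GSBeuBdd d M A B) :
    ∃ w : ℕ → ℝ, (∀ n, 0 ≤ w n) ∧ (∀ n : ℕ, w n ≤ n + 1) ∧
      (∀ m : ℝ, 0 ≤ m → ∃ C, ∀ t, m * countSum 1 β k t ≤ countSum w β k t + C) ∧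
      LineBounded (countSum 1 β k) A (2 * L)
        ((fun (φ : Rd d → ℂ) ξ => Complex.exp (expSum w β k (((‖ξ‖ ^ 2 : ℝ) : ℂ))) * 𝓕 φ ξ) '' B) := by
  choose κ C₁ hκ hC₁ hlow using fun K' : ℕ => hlow K' K'.cast_nonneg
  have hκ0 : ∀ K', 0 < κ K' := fun K' => zero_lt_one.trans_le (hκ K')
  choose D hD hDb using fun R K' : ℕ => hB.exists_fourier_bound hM hA hA2 (R := R + 1)
    (κ := 2 * (d + 1) * κ K') (by positivity) (mul_pos (by positivity) (hκ0 K'))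
  obtain ⟨w, hw0, hw, hdom, hdiag⟩ :=
    exists_diagonal_weights hβ hs hk (fun R K' => C₁ K' * D R K')
  refine ⟨w, hw0, hw, hdom, fun R m hm => ?_⟩
  obtain ⟨K, hK, hb⟩ := exists_expSum_bounds hβ hs hk hw0 hw (R := R + 1) (by positivity)
  obtain ⟨C₂, hC₂, hdiag⟩ := hdiag R (K + m) (by positivity)
  obtain ⟨C₃, hC₃⟩ := hdom 1 zero_le_one
  set T : ℝ := 2 * (d + 1) * (R + 1) with hT
  set c₁ := C₂ * Real.exp (K + m * C₃) with hc₁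
  set c₂ := Real.exp (K * countSum w β k T + K + m * countSum 1 β k T) * D R 0 with hc₂
  have hDR := hD R
  refine ⟨C * (c₁ + c₂), by have := hDR 0; positivity, ?_⟩
  rintro _ ⟨φ, hφ, rfl⟩ ξ v hv G P b hG hP hPb hGP p
  have hb0 : 0 ≤ b := (norm_nonneg _).trans (hPb 0 (by rw [norm_zero]; positivity))
  have hAp := hA.pos p
  have hFs : ContDiff ℝ ∞ (𝓕 φ) := by
    have := (hB.rapidDecay_pD hM hA hφ 0).contDiff_fourier
    rwa [pD_zero] at this
  have hsm : ContDiff ℝ ∞ fun η : Rd d =>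
      G η * (Complex.exp (expSum w β k (((‖η‖ ^ 2 : ℝ) : ℂ))) * 𝓕 φ η) :=
    hG.mul ((contDiff_expSum_norm_sq hβ hs hk hw0 hw).cexp.mul hFs)
  have hHd : Differentiable ℂ fun z => P z * Complex.exp (expSum w β k (lineNormSq ξ v z)) :=
    hP.mul ((differentiable_expSum hβ hs hk hw0 hw).comp (differentiable_lineNormSq ξ v)).cexp
  have hHb : ∀ z : ℂ, ‖z‖ ≤ R + 1 → ‖P z * Complex.exp (expSum w β k (lineNormSq ξ v z))‖ ≤
      b * Real.exp (K * countSum w β k ‖ξ‖ + K) := by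
    intro z hz
    rw [norm_mul, Complex.norm_exp]
    gcongr
    · exact hPb z hz
    · exact (Complex.re_le_norm _).trans
        (hb ‖ξ‖ (norm_nonneg _) _ (norm_lineNormSq_sub_le ξ hv hz)).1
  rcases le_or_gt ‖ξ‖ T with hξ | hξ
  · have key := norm_dirD_iterate_le hA.pos hA.mul_le_add hC hL hfact (R := R + 1) (by positivity)
      (hDR 0) hsm hFs (ξ := ξ) (v := v) hHd.differentiableOn hHb
      (fun τ _ => by simp only [hGP, lineNormSq_ofReal]; ring)
      (fun q => (hDb R 0 φ hφ v hv q ξ).1) p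
    refine key.trans ?_
    have h1 := countSum_mono (k := k) hβ hs hw0 hw (norm_nonneg _) hξ
    have h2 := countSum_mono (k := k) hβ hs (w := 1) (fun _ => zero_le_one) one_le_add_one
      (norm_nonneg _) hξ
    have h3 : Real.exp (K * countSum w β k ‖ξ‖ + K) * D R 0 ≤
        (c₁ + c₂) * Real.exp (-(m * countSum 1 β k ‖ξ‖)) := by
      calc Real.exp (K * countSum w β k ‖ξ‖ + K) * D R 0
          ≤ c₂ * Real.exp (-(m * countSum 1 β k ‖ξ‖)) := by
            rw [hc₂, mul_right_comm, ← Real.exp_add]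
            have h4 := mul_le_mul_of_nonneg_left h1 hK
            have h5 := mul_le_mul_of_nonneg_left h2 hm
            exact mul_le_mul_of_nonneg_right (Real.exp_le_exp.2 (by linarith)) (hDR 0)
        _ ≤ _ := by
            gcongr
            exact le_add_of_nonneg_left (by positivity)
    calc C * (b * Real.exp (K * countSum w β k ‖ξ‖ + K)) * D R 0 * (2 * L / (R + 1)) ^ p * A p
        = C * b * (2 * L / (R + 1)) ^ p * A p *
          (Real.exp (K * countSum w β k ‖ξ‖ + K) * D R 0) := by ring
      _ ≤ C * b * (2 * L / (R + 1)) ^ p * A p *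
          ((c₁ + c₂) * Real.exp (-(m * countSum 1 β k ‖ξ‖))) := by gcongr
      _ = _ := by ring
  · have hT0 : 0 < T := by positivity
    have hξ0 : 0 < ‖ξ‖ := hT0.trans hξ
    obtain ⟨i, hi⟩ := exists_norm_div_le_abs_coord hξ0
    obtain ⟨K', hK'⟩ := hdiag ‖ξ‖ hξ0.le
    obtain ⟨a, ha⟩ := hlow K' ‖ξ‖ hξ0.le
    have hMa := hM.pos a
    have hκK := hκ0 K'
    have hξd : 2 * (R + 1) < ‖ξ‖ / (d + 1) := by
      rw [lt_div_iff₀ (by positivity)]; rw [hT] at hξ; linarith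
    have hlowc : ∀ z : ℂ, ‖ξ‖ / (d + 1) - ‖z‖ ≤ ‖(ξ i : ℂ) + z * (v i : ℂ)‖ := by
      intro z
      have h1 : ‖z * (v i : ℂ)‖ ≤ ‖z‖ := by
        rw [norm_mul, Complex.norm_real]
        exact mul_le_of_le_one_right (norm_nonneg _) ((PiLp.norm_apply_le v i).trans hv)
      have h2 := norm_sub_le_norm_add (ξ i : ℂ) (z * (v i : ℂ))
      rw [Complex.norm_real, Real.norm_eq_abs] at h2
      linarith
    have hne : ∀ z : ℂ, ‖z‖ < 2 * (R + 1) → (ξ i : ℂ) + z * (v i : ℂ) ≠ 0 := by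
      intro z hz
      rw [← norm_pos_iff]
      have := hlowc z
      linarith
    have hgs : ContDiff ℝ ∞ fun η : Rd d => (η i : ℂ) ^ a * 𝓕 φ η :=
      ((Complex.ofRealCLM.contDiff.comp (EuclideanSpace.proj (𝕜 := ℝ) i).contDiff).pow a).mul hFs
    have key := norm_dirD_iterate_le hA.pos hA.mul_le_add hC hL hfact (R := R + 1) (by positivity)
      (D := D R K' * (M a / (2 * (d + 1) * κ K') ^ a)) (by have := hDR K'; positivity) hsm hgs
      (ξ := ξ) (v := v)
      (H := fun z => P z * Complex.exp (expSum w β k (lineNormSq ξ v z)) *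
        (((ξ i : ℂ) + z * (v i : ℂ)) ^ a)⁻¹)
      (B := b * Real.exp (K * countSum w β k ‖ξ‖ + K) * ((‖ξ‖ / (2 * (d + 1))) ^ a)⁻¹)
      (hHd.differentiableOn.mul (DifferentiableOn.inv (by fun_prop)
        fun z hz => pow_ne_zero _ (hne z (by simpa using hz))))
      (fun z hz => ?_) (fun τ hτ => ?_)
      (fun q => (hDb R K' φ hφ v hv q ξ).2 i a) p
    · refine key.trans ?_
      have h1 : ((‖ξ‖ / (2 * (d + 1))) ^ a)⁻¹ * (M a / (2 * (d + 1) * κ K') ^ a) ≤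
          C₁ K' * Real.exp (-(K' * countSum 1 β k ‖ξ‖)) := by
        have h2 : ((‖ξ‖ / (2 * (d + 1))) ^ a)⁻¹ * (M a / (2 * (d + 1) * κ K') ^ a) =
            M a / (κ K' * ‖ξ‖) ^ a := by
          simp only [div_pow, mul_pow]
          field_simp
        rw [h2, div_le_iff₀ (by positivity), Real.exp_neg, mul_right_comm, ← div_eq_mul_inv,
          le_div_iff₀ (Real.exp_pos _)]
        exact ha
      have h3 : Real.exp (K * countSum w β k ‖ξ‖ + K) *
          (C₂ * Real.exp (-((K + m) * countSum w β k ‖ξ‖))) ≤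
          (c₁ + c₂) * Real.exp (-(m * countSum 1 β k ‖ξ‖)) := by
        calc _ = C₂ * Real.exp (K * countSum w β k ‖ξ‖ + K + -((K + m) * countSum w β k ‖ξ‖)) := by
              rw [Real.exp_add _ (-_)]; ring
          _ ≤ c₁ * Real.exp (-(m * countSum 1 β k ‖ξ‖)) := by
              rw [hc₁, mul_assoc, ← Real.exp_add]
              have := mul_le_mul_of_nonneg_left (hC₃ ‖ξ‖) hm
              exact mul_le_mul_of_nonneg_left (Real.exp_le_exp.2 (by linarith)) hC₂.le
          _ ≤ _ := by
              gcongr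
              exact le_add_of_nonneg_right (mul_nonneg (Real.exp_pos _).le (hDR 0))
      have hDK := hDR K'
      calc C * (b * Real.exp (K * countSum w β k ‖ξ‖ + K) * ((‖ξ‖ / (2 * (d + 1))) ^ a)⁻¹) *
            (D R K' * (M a / (2 * (d + 1) * κ K') ^ a)) * (2 * L / (R + 1)) ^ p * A p
          = C * b * (2 * L / (R + 1)) ^ p * A p * (Real.exp (K * countSum w β k ‖ξ‖ + K) * (D R K' *
            (((‖ξ‖ / (2 * (d + 1))) ^ a)⁻¹ * (M a / (2 * (d + 1) * κ K') ^ a)))) := by ring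
        _ ≤ C * b * (2 * L / (R + 1)) ^ p * A p * (Real.exp (K * countSum w β k ‖ξ‖ + K) * (D R K' *
            (C₁ K' * Real.exp (-(K' * countSum 1 β k ‖ξ‖))))) := by gcongr
        _ = C * b * (2 * L / (R + 1)) ^ p * A p * (Real.exp (K * countSum w β k ‖ξ‖ + K) *
            (C₁ K' * D R K' * Real.exp (-(K' * countSum 1 β k ‖ξ‖)))) := by ring
        _ ≤ C * b * (2 * L / (R + 1)) ^ p * A p * (Real.exp (K * countSum w β k ‖ξ‖ + K) *
            (C₂ * Real.exp (-((K + m) * countSum w β k ‖ξ‖)))) := by gcongr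
        _ ≤ C * b * (2 * L / (R + 1)) ^ p * A p *
            ((c₁ + c₂) * Real.exp (-(m * countSum 1 β k ‖ξ‖))) := by gcongr
        _ = _ := by ring
    · rw [norm_mul, norm_inv, norm_pow]
      have h1 := hlowc z
      have h2 : ‖ξ‖ / (2 * (d + 1)) ≤ ‖(ξ i : ℂ) + z * (v i : ℂ)‖ := by
        have : ‖ξ‖ / (2 * (d + 1)) = ‖ξ‖ / (d + 1) / 2 := by field_simp
        linarith
      gcongr
      exact hHb z hz
    · have h1 := hne τ (by rw [Complex.norm_real, Real.norm_eq_abs]; linarith [abs_nonneg τ])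
      have h2 : ((ξ + τ • v) i : ℂ) = (ξ i : ℂ) + τ * (v i : ℂ) := by simp
      simp only [hGP, lineNormSq_ofReal, h2]
      field_simp

end

section

variable {d : ℕ} {M A : ℕ → ℝ}

lemma GSBeu.gsBeuBdd_singleton {φ : Rd d → ℂ} (hφ : GSBeu d M A φ) : GSBeuBdd d M A {φ} := by
  refine ⟨by rintro _ rfl; exact hφ, fun h hh => ?_⟩
  obtain ⟨C, hC⟩ := hφ.2 h hh
  exact ⟨C, by rintro _ rfl; exact hC⟩

lemma GSBeu.rapidDecay (hM : IsWeightSeq M) (hA : IsWeightSeq A) {φ : Rd d → ℂ}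
    (hφ : GSBeu d M A φ) : RapidDecay φ := by
  have := hφ.gsBeuBdd_singleton.rapidDecay_pD hM hA rfl 0
  rwa [pD_zero] at this

lemma GSBeu.rapidDecay_fourier (hM : IsWeightSeq M) (hA : IsWeightSeq A) (hA2 : M2 A)
    {φ : Rd d → ℂ} (hφ : GSBeu d M A φ) : RapidDecay (𝓕 φ) := by
  refine ⟨(hφ.rapidDecay hM hA).contDiff_fourier.continuous, fun n => ?_⟩
  obtain ⟨D, hD, hb⟩ := hφ.gsBeuBdd_singleton.exists_fourier_bound hM hA hA2 one_pos one_pos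
  have hA0 := hA.pos 0
  have hMn := hM.pos n
  refine ⟨D * A 0 + (d + 1) ^ n * (D * M n * A 0), fun ξ => ?_⟩
  obtain ⟨h1, h2⟩ := hb φ rfl 0 (by simp) 0 ξ
  simp only [Function.iterate_zero, id, pow_zero, div_one, one_pow] at h1 h2
  rcases (norm_nonneg ξ).eq_or_lt with h0 | h0
  · rw [← h0]
    have : (0 : ℝ) ^ n * ‖𝓕 φ ξ‖ ≤ 1 * ‖𝓕 φ ξ‖ := by
      gcongr
      exact pow_le_one₀ le_rfl zero_le_one
    have : 0 ≤ ((d : ℝ) + 1) ^ n * (D * M n * A 0) := by positivity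
    linarith
  · obtain ⟨i, hi⟩ := exists_norm_div_le_abs_coord h0
    rw [div_le_iff₀ (by positivity)] at hi
    have h3 := h2 i n
    rw [norm_mul, norm_pow, Complex.norm_real, Real.norm_eq_abs] at h3
    have : 0 ≤ D * A 0 := by positivity
    calc ‖ξ‖ ^ n * ‖𝓕 φ ξ‖ ≤ (|ξ i| * (d + 1)) ^ n * ‖𝓕 φ ξ‖ := by gcongr
      _ = (d + 1) ^ n * (|ξ i| ^ n * ‖𝓕 φ ξ‖) := by rw [mul_pow]; ring
      _ ≤ (d + 1) ^ n * (D * M n * A 0) := by gcongr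
      _ ≤ _ := by linarith

lemma GSBeu.fourierInv_fourier (hM : IsWeightSeq M) (hA : IsWeightSeq A) (hA2 : M2 A)
    {φ : Rd d → ℂ} (hφ : GSBeu d M A φ) : 𝓕⁻ (𝓕 φ) = φ :=
  hφ.1.continuous.fourierInv_fourier_eq (hφ.rapidDecay hM hA).integrable
    (hφ.rapidDecay_fourier hM hA hA2).integrable

lemma GSBeu.exists_mul_exp_nuA_le (hM : IsWeightSeq M) (hA : IsWeightSeq A) (hA2 : M2 A)
    {φ : Rd d → ℂ} (hφ : GSBeu d M A φ) {h : ℝ} (hh : 0 < h) :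
    ∃ K, 0 ≤ K ∧ ∀ t, ‖φ t‖ * Real.exp (nuA A (h * ‖t‖)) ≤ K * decayWeight d t := by
  obtain ⟨C₀, H, hC₀, hH, h2⟩ := hA2
  obtain ⟨C, hC, hb⟩ := hφ.gsBeuBdd_singleton.exists_bound hM hA (h := h * H) (by positivity)
  have hb : ∀ p x, (h * H * ‖x‖) ^ p * ‖φ x‖ ≤ C * A p := fun p x => by
    simpa [pD_zero, msize, hM.2.1] using hb φ rfl 0 p x
  have hAd := hA.pos (d + 1)
  have hH0 : 0 < H := by positivity
  refine ⟨2 ^ d * (C + C * C₀ * A (d + 1) / h ^ (d + 1)), by positivity, fun t => ?_⟩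
  have hht : 0 ≤ h * ‖t‖ := by positivity
  refine norm_le_decayWeight ?_ ?_ (by positivity)
  · refine hA.mul_exp_nuA_le hht (norm_nonneg _) fun p => ?_
    refine le_trans ?_ (hb p t)
    gcongr
    exact le_mul_of_one_le_right hh.le hH
  · rw [← mul_assoc]
    refine hA.mul_exp_nuA_le hht (by positivity) fun p => ?_
    have hAp := hA.pos p
    have h3 : H ^ (p + (d + 1)) * ((h * ‖t‖) ^ p * (h * ‖t‖) ^ (d + 1) * ‖φ t‖) ≤
        H ^ (p + (d + 1)) * (C * C₀ * A p * A (d + 1)) := by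
      calc _ = (h * H * ‖t‖) ^ (p + (d + 1)) * ‖φ t‖ := by
            rw [← pow_add, ← mul_assoc, ← mul_pow]; ring
        _ ≤ C * A (p + (d + 1)) := hb _ t
        _ ≤ C * (C₀ * H ^ (p + (d + 1)) * A p * A (d + 1)) := by gcongr; exact h2 p (d + 1)
        _ = _ := by ring
    have h4 := le_of_mul_le_mul_left h3 (by positivity)
    calc (h * ‖t‖) ^ p * (‖t‖ ^ (d + 1) * ‖φ t‖)
        = ((h * ‖t‖) ^ p * (h * ‖t‖) ^ (d + 1) * ‖φ t‖) / h ^ (d + 1) := by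
          rw [mul_pow h ‖t‖ (d + 1)]; field_simp
      _ ≤ (C * C₀ * A p * A (d + 1)) / h ^ (d + 1) := by gcongr
      _ = _ := by ring

lemma IsWeightSeq.exp_nuA_le_mul (hA : IsWeightSeq A) {h : ℝ} (hh : 0 ≤ h) (x t : Rd d) :
    Real.exp (nuA A (h * ‖x‖)) ≤
      Real.exp (nuA A (2 * h * ‖t‖)) * Real.exp (nuA A (2 * h * ‖x - t‖)) := by
  have h1 : ‖x‖ ≤ ‖t‖ + ‖x - t‖ := by simpa using norm_add_le t (x - t)
  rcases le_total ‖t‖ ‖x - t‖ with h2 | h2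
  · refine (hA.exp_nuA_mono (by positivity) (t := 2 * h * ‖x - t‖) ?_).trans
      (le_mul_of_one_le_left (Real.exp_pos _).le (hA.one_le_exp_nuA (by positivity)))
    nlinarith
  · refine (hA.exp_nuA_mono (by positivity) (t := 2 * h * ‖t‖) ?_).trans
      (le_mul_of_one_le_right (Real.exp_pos _).le (hA.one_le_exp_nuA (by positivity)))
    nlinarith

lemma RapidDecay.fourier_mul {φ Φ : Rd d → ℂ} (hφ : RapidDecay φ) (hΦ : RapidDecay Φ) :
    RapidDecay (fun ξ => 𝓕 φ ξ * Φ ξ) :=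
  hΦ.mul_bounded hφ.contDiff_fourier.continuous (norm_fourier_le_integral φ)

theorem GSBeu.convF (hM : IsWeightSeq M) (hA : IsWeightSeq A) (hA2 : M2 A) {ψ χ : Rd d → ℂ}
    (hψ : GSBeu d M A ψ) (hχ : GSBeu d M A χ) : GSBeu d M A (convF ψ χ) := by
  have hψr := hψ.rapidDecay hM hA
  have hχr := hχ.rapidDecay_fourier hM hA hA2
  have e : _root_.convF ψ χ = 𝓕⁻ (fun ξ => 𝓕 ψ ξ * 𝓕 χ ξ) := by
    rw [← convF_fourierInv hψr.integrable hχr.integrable, hχ.fourierInv_fourier hM hA hA2]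
  have hpD : ∀ α, pD α (_root_.convF ψ χ) = _root_.convF ψ (pD α χ) := by
    intro α
    obtain ⟨h1, h2⟩ := hχr.pD_fourierInv α
    rw [hχ.fourierInv_fourier hM hA hA2] at h2
    rw [e, ((hψr.fourier_mul hχr).pD_fourierInv α).2, h2,
      convF_fourierInv hψr.integrable h1.integrable]
    congr 1; ext ξ; ring
  refine ⟨e ▸ (hψr.fourier_mul hχr).contDiff_fourierInv, fun h hh => ?_⟩
  obtain ⟨K, hK, hKb⟩ := hψ.exists_mul_exp_nuA_le hM hA hA2 (h := 2 * h) (by positivity)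
  obtain ⟨C, hC⟩ := hχ.2 (2 * h) (by positivity)
  refine ⟨K * C * ∫ t : Rd d, decayWeight d t, fun α x => ?_⟩
  set c := h ^ msize α * Real.exp (nuA A (h * ‖x‖)) with hc
  have hc0 : 0 < c := by positivity
  rw [hpD, mul_right_comm, ← hc, _root_.convF, ← le_div_iff₀' hc0]
  refine (norm_integral_le_of_norm_le ((integrable_decayWeight d).const_mul
    (K * (C * M (msize α)) / c)) (Eventually.of_forall fun t => ?_)).trans (le_of_eq ?_)
  · rw [norm_mul, div_mul_eq_mul_div, le_div_iff₀ hc0]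
    have h1 := hC α (x - t)
    have h2 := hKb t
    have h3 := hA.exp_nuA_le_mul hh.le x t
    have h4 : h ^ msize α ≤ (2 * h) ^ msize α := by gcongr; linarith
    have h5 := decayWeight_pos t
    calc ‖ψ t‖ * ‖pD α χ (x - t)‖ * c
        ≤ ‖ψ t‖ * ‖pD α χ (x - t)‖ * ((2 * h) ^ msize α *
          (Real.exp (nuA A (2 * h * ‖t‖)) * Real.exp (nuA A (2 * h * ‖x - t‖)))) := by
          rw [hc]; gcongr
      _ = (‖ψ t‖ * Real.exp (nuA A (2 * h * ‖t‖))) *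
          ((2 * h) ^ msize α * ‖pD α χ (x - t)‖ * Real.exp (nuA A (2 * h * ‖x - t‖))) := by ring
      _ ≤ (K * decayWeight d t) * (C * M (msize α)) := by gcongr
      _ = _ := by ring
  · rw [integral_const_mul]; ring

lemma KBeu.gsBeu (hA : IsWeightSeq A) (hfact : factSubset A) {φ : Rd d → ℂ} (hφ : KBeu d M φ) :
    GSBeu d M A φ := by
  refine ⟨hφ.1, fun h hh => ?_⟩
  obtain ⟨C, L, hC, hL, hCL⟩ := hfact
  obtain ⟨n, hn⟩ := exists_nat_ge (h * L)
  obtain ⟨C', hC'⟩ := hφ.2 h hh n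
  refine ⟨C * C', fun α x => ?_⟩
  rw [mul_assoc C]
  refine hA.mul_exp_nuA_le (by positivity) (by positivity) fun p => ?_
  have hAp := hA.pos p
  have h1 : (h * ‖x‖) ^ p ≤ Real.exp (n * ‖x‖) * (C * A p) := by
    have h2 := Real.pow_div_factorial_le_exp (h * L * ‖x‖) (by positivity) p
    rw [div_le_iff₀ (by positivity)] at h2
    refine le_of_mul_le_mul_left ?_ (by positivity : 0 < L ^ p)
    calc L ^ p * (h * ‖x‖) ^ p = (h * L * ‖x‖) ^ p := by rw [← mul_pow]; ring
      _ ≤ Real.exp (h * L * ‖x‖) * p.factorial := h2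
      _ ≤ Real.exp (n * ‖x‖) * (C * L ^ p * A p) := by gcongr; exact hCL p
      _ = _ := by ring
  calc (h * ‖x‖) ^ p * (h ^ msize α * ‖pD α φ x‖)
      ≤ Real.exp (n * ‖x‖) * (C * A p) * (h ^ msize α * ‖pD α φ x‖) := by gcongr
    _ = C * A p * (h ^ msize α * ‖pD α φ x‖ * Real.exp (n * ‖x‖)) := by ring
    _ ≤ C * A p * (C' * M (msize α)) :=
        mul_le_mul_of_nonneg_left (hC' α x) (by positivity)
    _ = _ := by ring

/-- Bounded sets in the Gelfand–Shilov space factor through a single element of `𝒦^{(M)}`. -/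
theorem GSBeuBdd.exists_factorization (hM : IsWeightSeq M) (hM2 : M2 M) (h2s : M2star M)
    (hA : IsWeightSeq A) (hA2 : M2 A) (hfact : factSubset A) {B : Set (Rd d → ℂ)}
    (hB : GSBeuBdd d M A B) :
    ∃ ψ : Rd d → ℂ, KBeu d M ψ ∧
      ∃ A' : Set (Rd d → ℂ), GSBeuBdd d M A A' ∧ (fun χ => convF ψ χ) '' A' = B := by
  obtain ⟨k, β, hk, hβ, hs, hup, hlow⟩ := exists_countSum hM hM2 h2s
  obtain ⟨C, L, hC, hL, hCL⟩ := id hfact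
  obtain ⟨w, hw0, hw, hdom, hlb⟩ := exists_lineBounded_exp_mul_fourier hM hA hA2
    (zero_le_one.trans hC) hL hCL hβ hs hk hlow hB
  have hlb' := lineBounded_exp_neg d hβ hs hk hw0 hw hdom
  have hEs := contDiff_expSum_norm_sq (d := d) hβ hs hk hw0 hw
  set e : Rd d → ℂ := fun ξ => expSum w β k (((‖ξ‖ ^ 2 : ℝ) : ℂ))
  have hsm' : ∀ Φ ∈ ({fun ξ => Complex.exp (-e ξ)} : Set (Rd d → ℂ)), ContDiff ℝ ∞ Φ := by
    rintro _ rfl; exact hEs.neg.cexp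
  have hsm : ∀ Φ ∈ (fun (φ : Rd d → ℂ) ξ => Complex.exp (e ξ) * 𝓕 φ ξ) '' B,
      ContDiff ℝ ∞ Φ := by
    rintro _ ⟨φ, hφ, rfl⟩
    exact hEs.cexp.mul ((hB.1 φ hφ).rapidDecay hM hA).contDiff_fourier
  have hψ : KBeu d M (𝓕⁻ fun ξ => Complex.exp (-e ξ)) :=
    hlb'.kBeu_fourierInv hM zero_le_two hup hsm' rfl
  have hψi := ((hψ.gsBeu hA hfact).rapidDecay hM hA).integrable
  have hrd := hlb'.rapidDecay hM.pos (fun p => by positivity) hup rfl (hsm' _ rfl).continuous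
  have hinv : 𝓕 (𝓕⁻ fun ξ => Complex.exp (-e ξ)) = fun ξ => Complex.exp (-e ξ) := by
    refine hrd.1.fourier_fourierInv_eq hrd.integrable ?_
    refine hψi.comp_neg.congr (Eventually.of_forall fun x => ?_)
    simp only [Real.fourierInv_eq_fourier_neg, neg_neg]
    rfl
  refine ⟨_, hψ, _, hlb.gsBeuBdd_fourierInv hM hA (by positivity) hup hsm, ?_⟩
  rw [Set.image_image, Set.image_image]
  refine (Set.image_congr fun φ hφ => ?_).trans (Set.image_id B)
  have hΦ : (fun ξ => Complex.exp (e ξ) * 𝓕 φ ξ) ∈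
    (fun (φ : Rd d → ℂ) ξ => Complex.exp (e ξ) * 𝓕 φ ξ) '' B := ⟨φ, hφ, rfl⟩
  rw [convF_fourierInv hψi (hlb.rapidDecay hM.pos hA.pos hup hΦ (hsm _ hΦ).continuous).integrable,
    hinv]
  simp only [← mul_assoc, ← Complex.exp_add, neg_add_cancel, Complex.exp_zero, one_mul]
  exact (hB.1 φ hφ).fourierInv_fourier hM hA hA2

end

/-- Strong factorization for Gelfand–Shilov spaces of Beurling type (Corollary 7.6). -/
theorem stmt16 (d : ℕ) (M A : ℕ → ℝ)
    (hM : IsWeightSeq M) (hM2 : M2 M) (h2s : M2star M)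
    (hA : IsWeightSeq A) (hA2 : M2 A) (hfact : factSubset A) :
    convSet {f | KBeu d M f} {f | GSBeu d M A f} = {f | GSBeu d M A f} ∧
    convSet {f | GSBeu d M A f} {f | GSBeu d M A f} = {f | GSBeu d M A f} ∧
    ∀ B : Set (Rd d → ℂ), GSBeuBdd d M A B →
      ∃ ψ : Rd d → ℂ, KBeu d M ψ ∧
        ∃ A' : Set (Rd d → ℂ), GSBeuBdd d M A A' ∧ (fun χ => convF ψ χ) '' A' = B := by
  have hfac : ∀ φ, GSBeu d M A φ → ∃ ψ, KBeu d M ψ ∧ ∃ χ, GSBeu d M A χ ∧ φ = convF ψ χ := by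
    intro φ hφ
    obtain ⟨ψ, hψ, A', hA', h⟩ :=
      hφ.gsBeuBdd_singleton.exists_factorization hM hM2 h2s hA hA2 hfact
    obtain ⟨χ, hχ, hφχ⟩ := h.symm.subset (Set.mem_singleton φ)
    exact ⟨ψ, hψ, χ, hA'.1 χ hχ, hφχ.symm⟩
  refine ⟨Set.Subset.antisymm ?_ ?_, Set.Subset.antisymm ?_ ?_,
    fun B hB => hB.exists_factorization hM hM2 h2s hA hA2 hfact⟩
  · rintro _ ⟨ψ, hψ, χ, hχ, rfl⟩
    exact (hψ.gsBeu hA hfact).convF hM hA hA2 hχ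
  · intro φ hφ
    obtain ⟨ψ, hψ, χ, hχ, h⟩ := hfac φ hφ
    exact ⟨ψ, hψ, χ, hχ, h⟩
  · rintro _ ⟨ψ, hψ, χ, hχ, rfl⟩
    exact hψ.convF hM hA hA2 hχ
  · intro φ hφ
    obtain ⟨ψ, hψ, χ, hχ, h⟩ := hfac φ hφ
    exact ⟨ψ, hψ.gsBeu hA hfact, χ, hχ, h⟩
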